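/- arXiv:2102.09352 — 2 statements merged into one kernel-verified Lean document; each statement's English description precedes it below -/
import Mathlib

section
/- Let f ∈ Diff¹_ω(D) be a C^∞ diffeomorphism (with C^∞ inverse) such that f(0) = 0 and f has no periodic point other than 0 (for every z ∈ D∖{0} and every integer n ≥ 1, f^n(z) ≠ z), i.e. f is a C^∞ irrational pseudo-rotation. Let α ∈ ℝ be the translation number of a lift of the circle diffeomorphism f|_{S¹}. Assume that α is irrational and super Liouville, i.e. the denominators (q_n) of the continued fraction expansion of α satisfy limsup_{n→∞} log(q_{n+1})/q_n = +∞. Then Cal₁(f) = 0. -/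
open MeasureTheory Metric Set Filter Topology
open scoped Real

noncomputable section

/-- The closed unit disk in `ℂ ≅ ℝ²`. -/
def Disk : Set ℂ := Metric.closedBall 0 1

/-- The unit circle, boundary of the closed unit disk. -/
def Circ : Set ℂ := Metric.sphere 0 1

/-- The standard Liouville form `λ_z(w) = (z₁ w₂ - z₂ w₁)/(2π)`, whose exterior
derivative is the normalized area form `ω = (1/π) du ∧ dv`. -/
def lform (z w : ℂ) : ℝ := (z.re * w.im - z.im * w.re) / (2 * Real.pi)

/-- An element of `Diff¹_ω(D)`: a `C¹` diffeomorphism of the closed unit disk onto itself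
whose Jacobian determinant equals `1` at every point. -/
structure SympDiff where
  toFun : ℂ → ℂ
  invFun : ℂ → ℂ
  mapsTo : Set.MapsTo toFun Disk Disk
  inv_mapsTo : Set.MapsTo invFun Disk Disk
  left_inv : ∀ z ∈ Disk, invFun (toFun z) = z
  right_inv : ∀ z ∈ Disk, toFun (invFun z) = z
  contDiffOn : ContDiffOn ℝ 1 toFun Disk
  inv_contDiffOn : ContDiffOn ℝ 1 invFun Disk
  jacobian : ∀ z ∈ Disk,
    LinearMap.det (fderivWithin ℝ toFun Disk z).toLinearMap = 1

/-- `A` is an action function of `f`: a `C¹` function with `dA = f*λ - λ` on the disk. -/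
def IsAction (f : SympDiff) (A : ℂ → ℝ) : Prop :=
  ContDiffOn ℝ 1 A Disk ∧
    ∀ z ∈ Disk, ∀ w : ℂ,
      fderivWithin ℝ A Disk z w =
        lform (f.toFun z) (fderivWithin ℝ f.toFun Disk z w) - lform z w

/-- `μ` is a Borel probability measure concentrated on the unit circle and invariant
under `f|_{S¹}`. -/
def IsInvariantCircleMeasure (f : SympDiff) (μ : Measure ℂ) : Prop :=
  IsProbabilityMeasure μ ∧ μ Circᶜ = 0 ∧ Measure.map f.toFun μ = μ

/-- `A` is a normalized action function of `f`: an action function whose integral over the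
circle with respect to some `f|_{S¹}`-invariant probability measure vanishes. -/
def IsNormalizedAction (f : SympDiff) (A : ℂ → ℝ) : Prop :=
  IsAction f A ∧
    ∃ μ : Measure ℂ, IsInvariantCircleMeasure f μ ∧ ∫ z, A z ∂μ = 0

/-- The `C⁰` distance between two disk diffeomorphisms (given with their inverses). -/
def d0 (f fi g gi : ℂ → ℂ) : ℝ :=
  max (⨆ z : Disk, ‖f (z : ℂ) - g (z : ℂ)‖) (⨆ z : Disk, ‖fi (z : ℂ) - gi (z : ℂ)‖)

/-- The `C¹` distance between two disk diffeomorphisms (given with their inverses). -/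
def d1 (f fi g gi : ℂ → ℂ) : ℝ :=
  max (d0 f fi g gi)
    (max (⨆ z : Disk, ‖fderivWithin ℝ f Disk (z : ℂ) - fderivWithin ℝ g Disk (z : ℂ)‖)
      (⨆ z : Disk, ‖fderivWithin ℝ fi Disk (z : ℂ) - fderivWithin ℝ gi Disk (z : ℂ)‖))

/-! ### Continuous logarithms -/

theorem exists_continuous_log {X : Type*} [TopologicalSpace X] [SimplyConnectedSpace X]
    [LocallyPathConnectedSpace X] {g : X → ℂ} (hg : Continuous g) (h0 : ∀ x, g x ≠ 0) :
    ∃ l : X → ℂ, Continuous l ∧ ∀ x, Complex.exp (l x) = g x := by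
  obtain ⟨x₀⟩ : Nonempty X := inferInstance
  obtain ⟨F, ⟨-, hF⟩, -⟩ := Complex.isCoveringMapOn_exp.existsUnique_continuousMap_lifts
    ⟨g, hg⟩ (a₀ := x₀) (Complex.exp_log (h0 x₀)) (fun x => h0 x)
  exact ⟨F, F.continuous, fun x => congrFun hF x⟩

theorem constOn_of_exp_eq_one {X : Type*} [TopologicalSpace X] {s : Set X}
    (hs : IsPreconnected s) {c : X → ℂ} (hc : ContinuousOn c s)
    (h1 : ∀ x ∈ s, Complex.exp (c x) = 1) {x y : X} (hx : x ∈ s) (hy : y ∈ s) : c x = c y :=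
  Complex.isCoveringMap_exp.constOn_of_comp hs hc
    (fun a ha b hb => Subtype.ext ((h1 a ha).trans (h1 b hb).symm)) hx hy

theorem const_of_exp_eq_one {X : Type*} [TopologicalSpace X] [PreconnectedSpace X] {c : X → ℂ}
    (hc : Continuous c) (h1 : ∀ x, Complex.exp (c x) = 1) (x y : X) : c x = c y :=
  constOn_of_exp_eq_one isPreconnected_univ hc.continuousOn (fun x _ => h1 x) trivial trivial

/-! ### Homeomorphisms of the plane preserving the orientation -/

/-- A homeomorphism of the plane preserves the orientation if the ratio
`(h z - h w) / (z - w)` has a continuous symmetric logarithm on pairs of distinct points. -/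
def OrientationPreserving (h : ℂ ≃ₜ ℂ) : Prop :=
  ∃ l : ℂ × ℂ → ℂ, ContinuousOn l {p | p.1 ≠ p.2} ∧
    (∀ z w, z ≠ w → Complex.exp (l (z, w)) = (h z - h w) / (z - w)) ∧
    ∀ z w, l (z, w) = l (w, z)

theorem OrientationPreserving.trans {h k : ℂ ≃ₜ ℂ} (hh : OrientationPreserving h)
    (hk : OrientationPreserving k) : OrientationPreserving (h.trans k) := by
  obtain ⟨l, lc, le, ls⟩ := hh
  obtain ⟨m, mc, me, ms⟩ := hk
  refine ⟨fun p => m (h p.1, h p.2) + l p, ?_, ?_, ?_⟩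
  · refine ContinuousOn.add (mc.comp (by fun_prop) ?_) lc
    intro p hp
    exact fun hne => hp (h.injective hne)
  · intro z w hzw
    have h1 : h z - h w ≠ 0 := sub_ne_zero.2 fun e => hzw (h.injective e)
    have h2 : z - w ≠ 0 := sub_ne_zero.2 hzw
    simp only [Complex.exp_add, le z w hzw, Homeomorph.trans_apply,
      me _ _ (fun e => hzw (h.injective e))]
    field_simp
  · intro z w
    simp only [ls z w, ms (h z)]

theorem OrientationPreserving.symm {h : ℂ ≃ₜ ℂ} (hh : OrientationPreserving h) :
    OrientationPreserving h.symm := by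
  obtain ⟨l, lc, le, ls⟩ := hh
  refine ⟨fun p => - l (h.symm p.1, h.symm p.2), ?_, ?_, ?_⟩
  · refine (lc.comp (by fun_prop) ?_).neg
    intro p hp
    exact fun hne => hp (h.symm.injective hne)
  · intro z w hzw
    simp only [Complex.exp_neg, le _ _ (fun e => hzw (h.symm.injective e)),
      Homeomorph.apply_symm_apply, inv_div]
  · intro z w
    simp only [ls]

theorem OrientationPreserving.of_norm_lt {h : ℂ ≃ₜ ℂ}
    (H : ∀ z w, z ≠ w → ‖(h z - h w) - (z - w)‖ < ‖z - w‖) : OrientationPreserving h := by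
  have key : ∀ z w, z ≠ w → (h z - h w) / (z - w) ∈ Complex.slitPlane := by
    intro z w hzw
    have h2 : z - w ≠ 0 := sub_ne_zero.2 hzw
    have : ‖(h z - h w) / (z - w) - 1‖ < 1 := by
      have e : (h z - h w) / (z - w) - 1 = ((h z - h w) - (z - w)) / (z - w) := by
        field_simp
      rw [e, norm_div, div_lt_one (norm_pos_iff.2 h2)]
      exact H z w hzw
    left
    have h3 := (abs_lt.1 ((Complex.abs_re_le_norm _).trans_lt this)).1
    simp only [Complex.sub_re, Complex.one_re] at h3
    linarith
  refine ⟨fun p => Complex.log ((h p.1 - h p.2) / (p.1 - p.2)), ?_, ?_, ?_⟩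
  · refine ContinuousOn.clog ?_ (fun p hp => key _ _ hp)
    refine ContinuousOn.div (by fun_prop) (by fun_prop) ?_
    intro p hp
    exact sub_ne_zero.2 hp
  · intro z w hzw
    exact Complex.exp_log (Complex.slitPlane_ne_zero (key z w hzw))
  · intro z w
    simp only
    rw [← neg_sub (h z), ← neg_sub z w, neg_div_neg_eq]

theorem OrientationPreserving.refl : OrientationPreserving (Homeomorph.refl ℂ) :=
  .of_norm_lt fun z w hzw => by simpa using sub_ne_zero.2 hzw

theorem orientationPreserving_translation (c : ℂ) :
    OrientationPreserving (Homeomorph.addRight c) :=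
  .of_norm_lt fun z w hzw => by simpa using sub_ne_zero.2 hzw

/-- A Lipschitz perturbation of the identity with constant less than one is an orientation
preserving homeomorphism. -/
theorem exists_homeomorph_of_lipschitz {u : ℂ → ℂ} {c : NNReal} (hc : c < 1)
    (hu : LipschitzWith c u) :
    ∃ h : ℂ ≃ₜ ℂ, OrientationPreserving h ∧ ∀ z, h z = z + u z := by
  have hA : ApproximatesLinearOn (fun z => z + u z)
      ((ContinuousLinearEquiv.refl ℝ ℂ : ℂ ≃L[ℝ] ℂ) : ℂ →L[ℝ] ℂ) univ c := by
    intro x _ y _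
    have := hu.dist_le_mul x y
    simp only [dist_eq_norm] at this
    simpa [add_sub_add_comm] using this
  have hc' : Subsingleton ℂ ∨
      c < ‖(((ContinuousLinearEquiv.refl ℝ ℂ).symm : ℂ ≃L[ℝ] ℂ) : ℂ →L[ℝ] ℂ)‖₊⁻¹ := by
    right
    have : ‖(((ContinuousLinearEquiv.refl ℝ ℂ).symm : ℂ ≃L[ℝ] ℂ) : ℂ →L[ℝ] ℂ)‖₊ = 1 := by
      have := ContinuousLinearMap.nnnorm_id (𝕜 := ℝ) (E := ℂ)
      exact this
    rw [this, inv_one]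
    exact hc
  refine ⟨hA.toHomeomorph _ hc', .of_norm_lt fun z w hzw => ?_, fun z => rfl⟩
  have h1 := hu.dist_le_mul z w
  simp only [dist_eq_norm] at h1
  have h2 : 0 < ‖z - w‖ := norm_pos_iff.2 (sub_ne_zero.2 hzw)
  have h3 : ‖u z - u w‖ < ‖z - w‖ := by
    have : (c : ℝ) < 1 := hc
    nlinarith
  have e : (hA.toHomeomorph _ hc') z - (hA.toHomeomorph _ hc') w - (z - w) = u z - u w := by
    change (z + u z) - (w + u w) - (z - w) = u z - u w
    ring
  rw [e]
  exact h3

theorem exists_bump {a b : ℂ} {ρ : ℝ} (hb : b ∈ ball a ρ) :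
    ∃ h : ℂ ≃ₜ ℂ, OrientationPreserving h ∧ (∀ z ∉ ball a ρ, h z = z) ∧ h a = b := by
  have hb' : ‖b - a‖ < ρ := by simpa [dist_eq_norm] using hb
  have hρ : 0 < ρ := (norm_nonneg _).trans_lt hb'
  set χ : ℂ → ℝ := fun z => max 0 (1 - ‖z - a‖ / ρ) with hχ
  have hlip : ∀ z w, |χ z - χ w| ≤ ‖z - w‖ / ρ := by
    intro z w
    have h1 : |χ z - χ w| ≤ |(1 - ‖z - a‖ / ρ) - (1 - ‖w - a‖ / ρ)| := by
      simp only [hχ]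
      rw [max_comm 0, max_comm 0]
      exact abs_max_sub_max_le_abs _ _ _
    refine h1.trans ?_
    have e : (1 - ‖z - a‖ / ρ) - (1 - ‖w - a‖ / ρ) = (‖w - a‖ - ‖z - a‖) / ρ := by ring
    rw [e, abs_div, abs_of_pos hρ]
    gcongr
    refine (abs_norm_sub_norm_le _ _).trans ?_
    rw [sub_sub_sub_cancel_right, norm_sub_rev]
  have hL : LipschitzWith (Real.toNNReal (‖b - a‖ / ρ)) (fun z => (χ z : ℂ) * (b - a)) := by
    refine LipschitzWith.of_dist_le_mul fun z w => ?_
    rw [Real.coe_toNNReal _ (by positivity), dist_eq_norm, dist_eq_norm, ← sub_mul, norm_mul,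
      ← Complex.ofReal_sub, Complex.norm_real, Real.norm_eq_abs]
    calc |χ z - χ w| * ‖b - a‖ ≤ ‖z - w‖ / ρ * ‖b - a‖ := by gcongr; exact hlip z w
      _ = ‖b - a‖ / ρ * ‖z - w‖ := by ring
  have hc : Real.toNNReal (‖b - a‖ / ρ) < 1 := by
    rw [Real.toNNReal_lt_one, div_lt_one hρ]
    exact hb'
  obtain ⟨h, hor, hh⟩ := exists_homeomorph_of_lipschitz hc hL
  refine ⟨h, hor, fun z hz => ?_, ?_⟩
  · have : χ z = 0 := by
      simp only [hχ]
      refine max_eq_left ?_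
      have : ρ ≤ ‖z - a‖ := by simpa [dist_eq_norm] using hz
      have : 1 ≤ ‖z - a‖ / ρ := (one_le_div hρ).2 this
      linarith
    rw [hh, this]
    simp
  · rw [hh]
    simp [hχ]

/-- In a connected open set any point can be moved to any other one by an orientation preserving
homeomorphism supported in this set. -/
theorem exists_move {U : Set ℂ} (hU : IsOpen U) (hc : IsPreconnected U) {a b : ℂ} (ha : a ∈ U)
    (hb : b ∈ U) :
    ∃ h : ℂ ≃ₜ ℂ, OrientationPreserving h ∧ (∀ z ∉ U, h z = z) ∧ h a = b := by
  refine hc.induction₂'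
    (fun a b => ∃ h : ℂ ≃ₜ ℂ, OrientationPreserving h ∧ (∀ z ∉ U, h z = z) ∧ h a = b)
    ?_ ?_ ha hb
  · intro x hx
    obtain ⟨ρ, hρ, hsub⟩ := Metric.isOpen_iff.1 hU x hx
    filter_upwards [mem_nhdsWithin_of_mem_nhds (ball_mem_nhds x hρ)] with y hy
    obtain ⟨h, h1, h2, h3⟩ := exists_bump hy
    refine ⟨⟨h, h1, fun z hz => h2 z fun hz' => hz (hsub hz'), h3⟩,
      ⟨h.symm, h1.symm, fun z hz => ?_, ?_⟩⟩
    · rw [Homeomorph.symm_apply_eq, h2 z fun hz' => hz (hsub hz')]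
    · rw [Homeomorph.symm_apply_eq, h3]
  · rintro x y z hx hy hz ⟨h, h1, h2, h3⟩ ⟨k, k1, k2, k3⟩
    refine ⟨h.trans k, h1.trans k1, fun w hw => ?_, ?_⟩
    · rw [Homeomorph.trans_apply, h2 w hw, k2 w hw]
    · rw [Homeomorph.trans_apply, h3, k3]

theorem mem_of_supported {φ : ℂ ≃ₜ ℂ} {U : Set ℂ} (hφ : ∀ z ∉ U, φ z = z) {z : ℂ} :
    φ z ∈ U ↔ z ∈ U := by
  constructor
  · intro h
    by_contra hz
    rw [hφ z hz] at h
    exact hz h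
  · intro h
    by_contra hz
    refine hz ?_
    rw [φ.injective (hφ _ hz)]
    exact h

/-! ### Brouwer homeomorphisms have no periodic points -/

/-- An orientation preserving homeomorphism of the plane without fixed points. -/
structure IsBrouwer (h : ℂ ≃ₜ ℂ) : Prop where
  orientationPreserving : OrientationPreserving h
  ne_self : ∀ z, h z ≠ z

theorem IsBrouwer.trans_move {h φ : ℂ ≃ₜ ℂ} {U : Set ℂ} (hh : IsBrouwer h)
    (hφ : OrientationPreserving φ) (hs : ∀ z ∉ U, φ z = z) (hU : ∀ z ∈ U, h z ∉ U) :
    IsBrouwer (h.trans φ) := by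
  refine ⟨hh.1.trans hφ, fun z hz => ?_⟩
  rw [Homeomorph.trans_apply] at hz
  by_cases hzU : h z ∈ U
  · have : z ∈ U := by
      rw [← hz]
      exact (mem_of_supported hs).2 hzU
    exact hU z this hzU
  · rw [hs _ hzU] at hz
    exact hh.2 z hz

theorem IsBrouwer.apply_apply_ne {h : ℂ ≃ₜ ℂ} (hh : IsBrouwer h) (x : ℂ) : h (h x) ≠ x := by
  intro hx
  obtain ⟨⟨l, lc, le, ls⟩, hne⟩ := hh
  obtain ⟨Λ, hΛ, hexp⟩ := exists_continuous_log (g := fun z => h z - z) (by fun_prop)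
    (fun z => sub_ne_zero.2 (hne z))
  have hl : Continuous fun z => l (h z, z) := by
    refine lc.comp_continuous (by fun_prop) fun z => hne z
  have hc : Continuous fun z => Λ (h z) - Λ z - l (h z, z) :=
    ((hΛ.comp h.continuous).sub hΛ).sub hl
  have h1 : ∀ z, Complex.exp (Λ (h z) - Λ z - l (h z, z)) = 1 := by
    intro z
    rw [Complex.exp_sub, Complex.exp_sub, hexp, hexp, le _ _ (hne z)]
    have a1 := sub_ne_zero.2 (hne z)
    have a2 := sub_ne_zero.2 (hne (h z))
    field_simp
  have h2 := const_of_exp_eq_one hc h1 x (h x)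
  simp only [hx] at h2
  rw [ls x (h x)] at h2
  have h3 : Λ (h x) - Λ x = 0 := by linear_combination h2 / 2
  have h4 : Complex.exp (Λ (h x)) = Complex.exp (Λ x) := by rw [sub_eq_zero.1 h3]
  rw [hexp, hexp, hx] at h4
  exact hne x (by linear_combination -h4 / 2)

/-- If there are no periodic points of period at most `n`, then a connected free set is disjoint
from its first `n` images. -/
theorem IsBrouwer.iterate_notMem_of_free {n : ℕ}
    (hP : ∀ m, 1 ≤ m → m ≤ n → ∀ h : ℂ ≃ₜ ℂ, IsBrouwer h → ∀ x, h^[m] x ≠ x)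
    {h : ℂ ≃ₜ ℂ} (hh : IsBrouwer h) {U : Set ℂ} (hU : IsOpen U) (hc : IsPreconnected U)
    (hfree : ∀ z ∈ U, h z ∉ U) (m : ℕ) (h1 : 1 ≤ m) (hm : m ≤ n) :
    ∀ x ∈ U, h^[m] x ∉ U := by
  induction m using Nat.strong_induction_on with
  | _ m ih =>
    intro x hx hx'
    obtain ⟨φ, φo, φs, φx⟩ := exists_move hU hc hx' hx
    refine hP m h1 hm (h.trans φ) (hh.trans_move φo φs hfree) x ?_
    have key : ∀ j < m, (h.trans φ)^[j] x = h^[j] x := by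
      intro j
      induction j with
      | zero => simp
      | succ j ihj =>
        intro hj
        rw [Function.iterate_succ_apply', ihj (by omega), Homeomorph.trans_apply,
          ← Function.iterate_succ_apply' h]
        exact φs _ (ih (j + 1) hj (by omega) (by omega) x hx)
    obtain ⟨k, rfl⟩ : ∃ k, m = k + 1 := ⟨m - 1, by omega⟩
    rw [Function.iterate_succ_apply', key k (by omega), Homeomorph.trans_apply,
      ← Function.iterate_succ_apply' h, φx]

theorem exists_thickening_forall_notMem {g : ℂ → ℂ} (hg : Continuous g) {K L : Set ℂ}
    (hK : IsCompact K) (hL : IsCompact L) (h : ∀ z ∈ K, g z ∉ L) :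
    ∃ ε > 0, ∀ δ ≤ ε, ∀ z ∈ thickening δ K, g z ∉ thickening δ L := by
  have hd : Disjoint (g '' K) L := by
    rw [Set.disjoint_left]
    rintro _ ⟨z, hz, rfl⟩
    exact h z hz
  obtain ⟨ε₁, h1, hd1⟩ := hd.exists_thickenings (hK.image hg) hL.isClosed
  obtain ⟨ε₂, h2, hs⟩ := hK.exists_thickening_subset_open
    (isOpen_thickening.preimage hg (t := thickening ε₁ (g '' K)))
    (fun z hz => self_subset_thickening h1 _ ⟨z, hz, rfl⟩)
  refine ⟨min ε₁ ε₂, lt_min h1 h2, fun δ hδ z hz hz' => ?_⟩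
  exact Set.disjoint_left.1 hd1 (hs (thickening_mono (hδ.trans (min_le_right _ _)) _ hz))
    (thickening_mono (hδ.trans (min_le_left _ _)) _ hz')

theorem IsBrouwer.exists_maximal_free_ball {h : ℂ ≃ₜ ℂ} (hh : IsBrouwer h) (x : ℂ) :
    ∃ r > 0, ∃ z ∈ sphere x r, h z ∈ sphere x r ∧ ∀ w ∈ ball x r, h w ∉ ball x r := by
  have hcont : Continuous fun z => max (dist z x) (dist (h z) x) := by fun_prop
  have htend : Tendsto (fun z => max (dist z x) (dist (h z) x)) (cocompact ℂ) atTop :=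
    tendsto_atTop_mono (fun z => le_max_left _ _) (tendsto_dist_right_cocompact_atTop x)
  obtain ⟨z, hz⟩ := hcont.exists_forall_le htend
  set r := max (dist z x) (dist (h z) x) with hr
  have hfree : ∀ w ∈ ball x r, h w ∉ ball x r := fun w h1 h2 =>
    absurd (hz w) (not_le.2 (max_lt h1 h2))
  have hr0 : 0 < r := by
    by_contra hneg
    have h1 : dist z x ≤ 0 := (le_max_left _ _).trans (not_lt.1 hneg)
    have h2 : dist (h z) x ≤ 0 := (le_max_right _ _).trans (not_lt.1 hneg)
    exact hh.2 z ((dist_le_zero.1 h2).trans (dist_le_zero.1 h1).symm)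
  have hcl : closure (ball x r) = closedBall x r := closure_ball x hr0.ne'
  have hz1 : z ∈ closure (ball x r) := by
    rw [hcl, mem_closedBall]
    exact le_max_left (dist z x) _
  have hz2 : h z ∈ closure (ball x r) := by
    rw [hcl, mem_closedBall]
    exact le_max_right (dist z x) _
  refine ⟨r, hr0, z, ?_, ?_, hfree⟩
  · refine le_antisymm (le_max_left _ _) (not_lt.1 fun hlt => ?_)
    obtain ⟨w, hw, hw'⟩ := mem_closure_iff.1 hz2 (h '' ball x r) (h.isOpen_image.2 isOpen_ball)
      ⟨z, hlt, rfl⟩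
    obtain ⟨v, hv, rfl⟩ := hw
    exact hfree v hv hw'
  · refine le_antisymm (le_max_right _ _) (not_lt.1 fun hlt => ?_)
    obtain ⟨w, hw, hw'⟩ := mem_closure_iff.1 hz1 (h ⁻¹' ball x r)
      (isOpen_ball.preimage h.continuous) hlt
    exact hfree w hw' hw

/-- Inductive step: from a periodic point of period `n + 3` one builds another Brouwer
homeomorphism with a periodic point of period at most `n + 2`. -/
theorem IsBrouwer.iterate_ne_of_forall_lt {n : ℕ}
    (hP : ∀ m, 1 ≤ m → m ≤ n + 2 → ∀ h : ℂ ≃ₜ ℂ, IsBrouwer h → ∀ x, h^[m] x ≠ x)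
    {h : ℂ ≃ₜ ℂ} (hh : IsBrouwer h) (x : ℂ) : h^[n + 3] x ≠ x := by
  intro hx
  obtain ⟨r, hr, z, hz, hhz, hfree⟩ := hh.exists_maximal_free_ball x
  have hfree2 : ∀ w ∈ ball x r, h (h w) ∉ ball x r := fun w hw =>
    hh.iterate_notMem_of_free hP isOpen_ball (convex_ball x r).isPreconnected hfree 2
      (by omega) (by omega) w hw
  have hcl : closure (ball x r) = closedBall x r := closure_ball x hr.ne'
  have hzcl : z ∈ closure (ball x r) := hcl ▸ sphere_subset_closedBall hz
  have hzB : z ∉ ball x r := fun h' => absurd (mem_ball.1 h') (not_lt.2 hz.ge)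
  have hhzB : h z ∉ ball x r := fun h' => absurd (mem_ball.1 h') (not_lt.2 hhz.ge)
  have hhhzB : h (h z) ∉ ball x r := by
    intro h'
    obtain ⟨w, hw', hw⟩ := mem_closure_iff.1 hzcl ((fun w => h (h w)) ⁻¹' ball x r)
      (isOpen_ball.preimage (by fun_prop)) h'
    exact hfree2 w hw hw'
  have hzhB : ∀ w ∈ ball x r, h w ≠ z := by
    intro w hw h'
    obtain ⟨v, hv, hv'⟩ := mem_closure_iff.1 hzcl (h '' ball x r) (h.isOpen_image.2 isOpen_ball)
      ⟨w, hw, h'⟩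
    obtain ⟨u, hu, rfl⟩ := hv
    exact hfree u hu hv'
  have hseg : ∀ y ∈ sphere x r, ∀ w ∈ segment ℝ x y, w ∈ ball x r ∨ w = y := by
    intro y hy w hw
    by_cases hwy : w = y
    · exact Or.inr hwy
    left
    rw [segment_eq_image_lineMap] at hw
    obtain ⟨t, ht, rfl⟩ := hw
    rw [mem_ball, dist_lineMap_left, Real.norm_eq_abs, abs_of_nonneg ht.1, dist_comm,
      mem_sphere.1 hy]
    have : t < 1 := lt_of_le_of_ne ht.2 fun e => hwy (by simp [e])
    nlinarith
  have hcomp : ∀ y : ℂ, IsCompact (segment ℝ x y) := fun y => by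
    rw [segment_eq_image_lineMap]
    exact isCompact_Icc.image (by fun_prop)
  obtain ⟨ε₁, e1, hε₁⟩ := exists_thickening_forall_notMem h.continuous (hcomp (h z))
    (hcomp (h z)) (by
      intro w hw hw'
      rcases hseg _ hhz w hw with h1 | rfl <;> rcases hseg _ hhz _ hw' with h2 | h2
      · exact hfree w h1 h2
      · exact hzB (h.injective h2 ▸ h1)
      · exact hhhzB h2
      · exact hh.2 _ h2)
  obtain ⟨ε₂, e2, hε₂⟩ := exists_thickening_forall_notMem h.continuous (hcomp z)
    (hcomp z) (by
      intro w hw hw'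
      rcases hseg _ hz w hw with h1 | rfl <;> rcases hseg _ hz _ hw' with h2 | h2
      · exact hfree w h1 h2
      · exact hzhB w h1 h2
      · exact hhzB h2
      · exact hh.2 _ h2)
  obtain ⟨ε₃, e3, hε₃⟩ := exists_thickening_forall_notMem (g := fun w => h (h w)) (by fun_prop)
    (hcomp z) (hcomp (h z)) (by
      intro w hw hw'
      rcases hseg _ hz w hw with h1 | rfl <;> rcases hseg _ hhz _ hw' with h2 | h2
      · exact hfree2 w h1 h2
      · exact hzhB w h1 (h.injective h2)
      · exact hhhzB h2
      · exact hh.2 _ h2)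
  set δ := min ε₁ (min ε₂ ε₃) with hδ
  have hδ0 : 0 < δ := lt_min e1 (lt_min e2 e3)
  replace hε₁ := hε₁ δ (min_le_left _ _)
  replace hε₂ := hε₂ δ ((min_le_right _ _).trans (min_le_left _ _))
  replace hε₃ := hε₃ δ ((min_le_right _ _).trans (min_le_right _ _))
  set V := thickening δ (segment ℝ x (h z))
  set S := thickening δ (segment ℝ x z)
  have hVo : IsOpen V := isOpen_thickening
  have hVc : IsPreconnected V := ((convex_segment _ _).thickening δ).isPreconnected
  have hSo : IsOpen (h '' S) := h.isOpen_image.2 isOpen_thickening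
  have hSc : IsPreconnected (h '' S) :=
    ((convex_segment _ _).thickening δ).isPreconnected.image _ h.continuous.continuousOn
  have hxV : x ∈ V := self_subset_thickening hδ0 _ (left_mem_segment _ _ _)
  have hzV : h z ∈ V := self_subset_thickening hδ0 _ (right_mem_segment _ _ _)
  have hxS : h x ∈ h '' S := ⟨x, self_subset_thickening hδ0 _ (left_mem_segment _ _ _), rfl⟩
  have hzS : h z ∈ h '' S := ⟨z, self_subset_thickening hδ0 _ (right_mem_segment _ _ _), rfl⟩
  have hSfree : ∀ w ∈ h '' S, h w ∉ h '' S := by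
    rintro _ ⟨w, hw, rfl⟩ ⟨v, hv, hv'⟩
    exact hε₂ w hw (h.injective hv' ▸ hv)
  obtain ⟨φ, φo, φs, φx⟩ := exists_move hVo hVc hxV hzV
  obtain ⟨χ, χo, χs, χx⟩ := exists_move hSo hSc hzS hxS
  have hB1 : IsBrouwer (h.trans φ) := hh.trans_move φo φs hε₁
  have hB2 : IsBrouwer ((h.trans φ).trans χ) := by
    refine hB1.trans_move χo χs ?_
    rintro _ ⟨w, hw, rfl⟩
    rw [Homeomorph.trans_apply, φs _ (hε₃ w hw)]
    exact hSfree _ ⟨w, hw, rfl⟩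
  have key : ∀ j ≤ n + 1, ((h.trans φ).trans χ)^[j] (h x) = h^[j + 1] x := by
    intro j
    induction j with
    | zero => simp
    | succ j ihj =>
      intro hj
      rw [Function.iterate_succ_apply', ihj (by omega), Homeomorph.trans_apply,
        Homeomorph.trans_apply, ← Function.iterate_succ_apply' h, φs, χs]
      · rw [Function.iterate_succ_apply]
        exact hh.iterate_notMem_of_free hP hSo hSc hSfree (j + 1) (by omega) (by omega) _ hxS
      · exact hh.iterate_notMem_of_free hP hVo hVc hε₁ (j + 2) (by omega) (by omega) _ hxV
  refine hP (n + 2) (by omega) le_rfl _ hB2 (h x) ?_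
  rw [Function.iterate_succ_apply', key _ le_rfl, Homeomorph.trans_apply,
    Homeomorph.trans_apply, ← Function.iterate_succ_apply' h, hx, φx, χx]

theorem IsBrouwer.iterate_ne {n : ℕ} (hn : 1 ≤ n) {h : ℂ ≃ₜ ℂ} (hh : IsBrouwer h) (x : ℂ) :
    h^[n] x ≠ x := by
  induction n using Nat.strong_induction_on generalizing h x with
  | _ n ih =>
    match n, hn with
    | 1, _ => exact hh.2 x
    | 2, _ => exact hh.apply_apply_ne x
    | n + 3, _ =>
      exact hh.iterate_ne_of_forall_lt (fun m h1 h2 k hk y => ih m (by omega) h1 hk y) x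

theorem IsBrouwer.iterate_notMem {h : ℂ ≃ₜ ℂ} (hh : IsBrouwer h) {U : Set ℂ} (hU : IsOpen U)
    (hc : IsPreconnected U) (hfree : ∀ z ∈ U, h z ∉ U) {n : ℕ} (hn : 1 ≤ n) :
    ∀ x ∈ U, h^[n] x ∉ U :=
  hh.iterate_notMem_of_free (fun _ hm _ _ hk y => hk.iterate_ne hm y) hU hc hfree n hn le_rfl

/-! ### Returns to a tile under a periodic Brouwer homeomorphism -/

/-- An open connected set which is disjoint from its translates by the nonzero multiples of `c`,
and all the translates of which are disjoint from its image under `h`. -/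
structure IsTile (c : ℂ) (h : ℂ → ℂ) (U : Set ℂ) : Prop where
  isOpen : IsOpen U
  isPreconnected : IsPreconnected U
  eq_zero : ∀ z ∈ U, ∀ j : ℤ, z - j * c ∈ U → j = 0
  free : ∀ z ∈ U, ∀ j : ℤ, h z - j * c ∉ U

theorem iterate_add_mul {h : ℂ → ℂ} {c : ℂ} (hc : ∀ z, h (z + c) = h z + c) (n : ℕ) (z : ℂ)
    (j : ℤ) : h^[n] (z + j * c) = h^[n] z + j * c := by
  have h1 : ∀ z, h^[n] (z + c) = h^[n] z + c := by
    induction n with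
    | zero => simp
    | succ n ih =>
      intro z
      rw [Function.iterate_succ_apply', ih, hc, Function.iterate_succ_apply']
  induction j with
  | zero => simp
  | succ j ih =>
    push_cast at ih ⊢
    rw [add_mul, one_mul, ← add_assoc, h1, ih, add_assoc]
  | pred j ih =>
    have := h1 (z + (-j - 1) * c)
    push_cast at ih ⊢
    rw [show z + (-j - 1) * c + c = z + -j * c by ring, ih] at this
    linear_combination -this

theorem IsTile.ne_zero_of_return {h : ℂ ≃ₜ ℂ} (hh : IsBrouwer h) {c : ℂ} {U : Set ℂ}
    (hU : IsTile c h U) {y : ℂ} {n : ℕ} {k : ℤ} (hn : 1 ≤ n) (hy : y ∈ U)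
    (hk : h^[n] y - k * c ∈ U) : k ≠ 0 := by
  rintro rfl
  refine hh.iterate_notMem hU.1 hU.2 (fun z hz hz' => hU.4 z hz 0 ?_) hn y hy ?_
  · simpa using hz'
  · simpa using hk

/-- If there is a return with a given sign of the translation, then there is a first return with
the same sign. -/
theorem exists_first_return {h : ℂ → ℂ} {c : ℂ} (hc : ∀ z, h (z + c) = h z + c) {U : Set ℂ}
    (s : ℤ) (n : ℕ) :
    ∀ y ∈ U, ∀ k : ℤ, 1 ≤ n → 0 < s * k → h^[n] y - k * c ∈ U →
    ∃ y' ∈ U, ∃ n' ≥ 1, ∃ k' : ℤ, 0 < s * k' ∧ h^[n'] y' - k' * c ∈ U ∧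
      ∀ i, 1 ≤ i → i < n' → ∀ j : ℤ, h^[i] y' - j * c ∉ U := by
  induction n using Nat.strong_induction_on with
  | _ n ih =>
    intro y hy k hn hk hr
    by_cases hfirst : ∀ i, 1 ≤ i → i < n → ∀ j : ℤ, h^[i] y - j * c ∉ U
    · exact ⟨y, hy, n, hn, k, hk, hr, hfirst⟩
    push Not at hfirst
    obtain ⟨i, hi1, hi2, j, hj⟩ := hfirst
    rcases lt_or_ge 0 (s * j) with hj0 | hj0
    · exact ih i hi2 y hy j hi1 hj0 hj
    · refine ih (n - i) (by omega) _ hj (k - j) (by omega) (by linarith [mul_sub s k j]) ?_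
      have e : h^[i] y - j * c = h^[i] y + (-j : ℤ) * c := by push_cast; ring
      rw [e, iterate_add_mul hc, ← Function.iterate_add_apply, Nat.sub_add_cancel hi2.le]
      convert hr using 1
      push_cast
      ring

/-- Finitely many translates of a tile can be modified simultaneously. -/
theorem IsTile.exists_move {h : ℂ → ℂ} {c : ℂ} {U : Set ℂ} (hU : IsTile c h U) (e d : ℤ → ℂ)
    (he : ∀ t : ℤ, e t - t * c ∈ U) (hd : ∀ t : ℤ, d t - t * c ∈ U) (F : Finset ℤ) :
    ∃ φ : ℂ ≃ₜ ℂ, OrientationPreserving φ ∧ (∀ z, (∀ t ∈ F, z - t * c ∉ U) → φ z = z) ∧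
      ∀ t ∈ F, φ (e t) = d t := by
  have huniq : ∀ z, ∀ s t : ℤ, z - s * c ∈ U → z - t * c ∈ U → s = t := by
    intro z s t hs ht
    have := hU.3 _ hs (t - s) (by
      convert ht using 1
      push_cast
      ring)
    omega
  induction F using Finset.induction_on with
  | empty => exact ⟨Homeomorph.refl ℂ, .refl, by simp, by simp⟩
  | insert t F htF ih =>
    obtain ⟨φ, φo, φs, φe⟩ := ih
    have hV : IsOpen ((fun z => z - t * c) ⁻¹' U) := hU.1.preimage (by fun_prop)
    have hVc : IsPreconnected ((fun z => z - t * c) ⁻¹' U) := by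
      have := hU.2.preimage_of_isOpenMap (f := (Homeomorph.addRight (-(t * c)) : ℂ → ℂ))
        (Homeomorph.injective _) (Homeomorph.isOpenMap _)
        (by rw [(Homeomorph.surjective _).range_eq]; exact subset_univ _)
      simpa [sub_eq_add_neg] using this
    obtain ⟨χ, χo, χs, χe⟩ := _root_.exists_move hV hVc (he t) (hd t)
    refine ⟨φ.trans χ, φo.trans χo, fun z hz => ?_, fun s hs => ?_⟩
    · rw [Homeomorph.trans_apply, φs z fun s hs => hz s (Finset.mem_insert_of_mem hs)]
      exact χs z (hz t (Finset.mem_insert_self _ _))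
    · rw [Homeomorph.trans_apply]
      rcases Finset.mem_insert.1 hs with rfl | hs
      · rw [φs _ fun t ht ht' => htF (huniq _ _ _ (he s) ht' ▸ ht), χe]
      · rw [φe s hs]
        exact χs _ fun ht => htF (huniq _ _ _ (hd s) ht ▸ hs)

/-- The returns to a tile all have the same sign. -/
theorem IsTile.pos_of_return {h : ℂ ≃ₜ ℂ} (hh : IsBrouwer h) {c : ℂ}
    (hc : ∀ z, h (z + c) = h z + c) {U : Set ℂ} (hU : IsTile c h U)
    {y y' : ℂ} {n n' : ℕ} {k k' : ℤ} (hn : 1 ≤ n) (hn' : 1 ≤ n') (hy : y ∈ U) (hy' : y' ∈ U)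
    (hk : h^[n] y - k * c ∈ U) (hk' : h^[n'] y' - k' * c ∈ U) (hk0 : 0 ≤ k) : 0 < k' := by
  by_contra hneg
  have h1 := hU.ne_zero_of_return hh hn hy hk
  have h2 := hU.ne_zero_of_return hh hn' hy' hk'
  obtain ⟨y, hy, n, hn, a, ha, hya, hfa⟩ :=
    exists_first_return hc 1 n y hy k hn (by omega) hk
  obtain ⟨y', hy', n', hn', b, hb, hyb, hfb⟩ :=
    exists_first_return hc (-1) n' y' hy' k' hn' (by omega) hk'
  obtain ⟨b, rfl⟩ : ∃ b', b = -b' := ⟨-b, by simp⟩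
  replace ha : 0 < a := by omega
  replace hb : 0 < b := by omega
  set d : ℤ → ℂ := fun t => (if t ≤ 0 then y else y') + t * c with hd
  set e : ℤ → ℂ := fun t =>
    if a - b < t then h^[n] y + (t - a : ℤ) * c else h^[n'] y' + (t + b : ℤ) * c with he
  obtain ⟨φ, φo, φs, φe⟩ := hU.exists_move e d
    (fun t => by
      simp only [he]
      split_ifs
      · convert hya using 1
        push_cast
        ring
      · convert hyb using 1
        push_cast
        ring)
    (fun t => by
      simp only [hd]
      split_ifs <;> simpa) (Finset.Ioc (-b) a)
  set W : Set ℂ := {z | ∃ j : ℤ, z - j * c ∈ U} with hW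
  have φs' : ∀ z ∉ W, φ z = z := fun z hz => φs z fun t _ ht => hz ⟨t, ht⟩
  have hB : IsBrouwer (h.trans φ) := by
    refine hh.trans_move φo φs' ?_
    rintro z ⟨j, hj⟩ ⟨i, hi⟩
    refine hU.4 _ hj (i - j) ?_
    have e1 : z - j * c = z + (-j : ℤ) * c := by push_cast; ring
    have := iterate_add_mul hc 1 z (-j)
    simp only [Function.iterate_one] at this
    rw [e1, this]
    convert hi using 1
    push_cast
    ring
  have htrack : ∀ (w : ℂ) (m : ℕ), 1 ≤ m → (∀ i, 1 ≤ i → i < m → h^[i] w ∉ W) →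
      (h.trans φ)^[m] w = φ (h^[m] w) := by
    intro w m hm
    induction m, hm using Nat.le_induction with
    | base => intro _; rfl
    | succ m hm ih =>
      intro hw
      rw [Function.iterate_succ_apply', ih fun i h1 h2 => hw i h1 (by omega),
        φs' _ (hw m hm (by omega)), Homeomorph.trans_apply, ← Function.iterate_succ_apply' h]
  have hnotW : ∀ (w : ℂ) (i : ℕ) (s : ℤ), (∀ j : ℤ, h^[i] w - j * c ∉ U) →
      h^[i] (w + s * c) ∉ W := by
    rintro w i s hw ⟨j, hj⟩
    refine hw (j - s) ?_
    rw [iterate_add_mul hc] at hj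
    convert hj using 1
    push_cast
    ring
  set g : ℤ → ℤ := fun s => if s ≤ 0 then s + a else s - b with hg
  have hgm : ∀ s ∈ Finset.Ioc (-b) a, g s ∈ Finset.Ioc (-b) a := by
    intro s hs
    simp only [hg, Finset.mem_Ioc] at hs ⊢
    split_ifs <;> omega
  have hstep : ∀ s ∈ Finset.Ioc (-b) a, ∃ m ≥ 1, (h.trans φ)^[m] (d s) = d (g s) := by
    intro s hs
    have hgs := φe _ (hgm s hs)
    rw [Finset.mem_Ioc] at hs
    by_cases h0 : s ≤ 0
    · refine ⟨n, hn, ?_⟩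
      have hds : d s = y + s * c := by simp [hd, h0]
      have hg' : g s = s + a := by simp [hg, h0]
      rw [← hgs, hds, htrack _ n hn fun i i1 i2 => hnotW _ _ _ (hfa i i1 i2),
        iterate_add_mul hc, hg']
      simp only [he]
      rw [if_pos (by omega), add_sub_cancel_right]
    · refine ⟨n', hn', ?_⟩
      have hds : d s = y' + s * c := by simp [hd, h0]
      have hg' : g s = s - b := by simp [hg, h0]
      rw [← hgs, hds, htrack _ n' hn' fun i i1 i2 => hnotW _ _ _ (hfb i i1 i2),
        iterate_add_mul hc, hg']
      simp only [he]
      rw [if_neg (by omega), sub_add_cancel]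
  have hgi : ∀ i, g^[i] 0 ∈ Finset.Ioc (-b) a := by
    intro i
    induction i with
    | zero => simp [hb, ha.le]
    | succ i ih =>
      rw [Function.iterate_succ_apply']
      exact hgm _ ih
  have hsteps : ∀ i j, ∃ m ≥ j, (h.trans φ)^[m] (d (g^[i] 0)) = d (g^[i + j] 0) := by
    intro i j
    induction j with
    | zero => exact ⟨0, le_rfl, rfl⟩
    | succ j ih =>
      obtain ⟨m, hm, e1⟩ := ih
      obtain ⟨m', hm', e2⟩ := hstep _ (hgi (i + j))
      refine ⟨m' + m, by omega, ?_⟩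
      rw [Function.iterate_add_apply, e1, e2, ← Function.iterate_succ_apply' g]
      rfl
  obtain ⟨i, j, hij, hije⟩ := Set.Finite.exists_lt_map_eq_of_forall_mem
    (f := fun i : ℕ => g^[i] 0) (t := ↑(Finset.Ioc (-b) a)) (fun i => hgi i)
    (Finset.finite_toSet _)
  obtain ⟨m, hm, hme⟩ := hsteps i (j - i)
  rw [Nat.add_sub_cancel' hij.le, ← hije] at hme
  exact hB.iterate_ne (by omega) _ hme

/-! ### A differential criterion for the preservation of the orientation -/

/-- A homeomorphism of the plane preserves the orientation as soon as it is close at one point to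
a similarity. -/
theorem OrientationPreserving.of_norm_sub_lt {h : ℂ ≃ₜ ℂ} {z₀ a : ℂ} {ρ : ℝ} (hρ : 0 < ρ)
    (H : ∀ v, v ≠ 0 → ‖v‖ < ρ → ‖(h (z₀ + v) - h z₀) - a * v‖ < ‖a‖ * ‖v‖) :
    OrientationPreserving h := by
  set Q : ℂ × ℂ → ℂ := fun p => (h (p.1 + Complex.exp p.2) - h p.1) / Complex.exp p.2 with hQ
  have hQ0 : ∀ p, Q p ≠ 0 := fun p =>
    div_ne_zero (sub_ne_zero.2 fun e => Complex.exp_ne_zero p.2 (by simpa using h.injective e))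
      (Complex.exp_ne_zero _)
  have hQc : Continuous Q := by
    refine Continuous.div ?_ ?_ fun p => Complex.exp_ne_zero _
    · exact (h.continuous.comp (by fun_prop)).sub (h.continuous.comp continuous_fst)
    · fun_prop
  obtain ⟨Θ, hΘ, hexp⟩ := exists_continuous_log hQc hQ0
  have hswap : ∀ p : ℂ × ℂ, Q (p.1 + Complex.exp p.2, p.2 + π * Complex.I) = Q p := by
    intro p
    simp only [hQ, Complex.exp_add, Complex.exp_pi_mul_I]
    rw [mul_neg_one, add_neg_cancel_right, div_neg, ← neg_div, neg_sub]
  obtain ⟨κ, hκ⟩ : ∃ κ, ∀ p : ℂ × ℂ,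
      Θ (p.1 + Complex.exp p.2, p.2 + π * Complex.I) = Θ p + κ := by
    refine ⟨Θ (0 + Complex.exp 0, 0 + π * Complex.I) - Θ (0, 0), fun p => ?_⟩
    have hc : Continuous fun p : ℂ × ℂ =>
        Θ (p.1 + Complex.exp p.2, p.2 + π * Complex.I) - Θ p :=
      (hΘ.comp (by fun_prop)).sub hΘ
    have := const_of_exp_eq_one hc (fun p => by
      rw [Complex.exp_sub, hexp, hexp, hswap, div_self (hQ0 p)]) p (0, 0)
    linear_combination this
  have hper : ∀ z t, Θ (z, t + 2 * π * Complex.I) = Θ (z, t) + 2 * κ := by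
    intro z t
    have h1 := hκ (z + Complex.exp t, t + π * Complex.I)
    have h2 := hκ (z, t)
    simp only [Complex.exp_add, Complex.exp_pi_mul_I, mul_neg_one, add_neg_cancel_right] at h1 h2
    rw [show t + 2 * π * Complex.I = t + π * Complex.I + π * Complex.I by ring, h1, h2]
    ring
  have ha : a ≠ 0 := by
    rintro rfl
    have h1 := H (ρ / 2 : ℝ) (by simpa using hρ.ne')
      (by rw [Complex.norm_real, Real.norm_eq_abs, abs_of_pos (by linarith)]; linarith)
    simp only [norm_zero, zero_mul] at h1
    exact absurd h1 (not_lt.2 (norm_nonneg _))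
  have hslit : ∀ t : ℂ, ‖Complex.exp t‖ < ρ → Q (z₀, t) / a ∈ Complex.slitPlane := by
    intro t ht
    have h1 := H _ (Complex.exp_ne_zero t) ht
    have h0 := Complex.exp_ne_zero t
    have h2 : ‖Q (z₀, t) / a - 1‖ < 1 := by
      have e : Q (z₀, t) / a - 1 =
          ((h (z₀ + Complex.exp t) - h z₀) - a * Complex.exp t) / (a * Complex.exp t) := by
        simp only [hQ]
        field_simp
      rw [e, norm_div, norm_mul, div_lt_one (by positivity)]
      exact h1
    left
    have h3 := (abs_lt.1 ((Complex.abs_re_le_norm _).trans_lt h2)).1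
    simp only [Complex.sub_re, Complex.one_re] at h3
    linarith
  have hκ0 : κ = 0 := by
    set R : ℝ := Real.log (ρ / 2) with hR
    have hnorm : ∀ s : ℝ, ‖Complex.exp (R + s * Complex.I)‖ < ρ := by
      intro s
      rw [Complex.norm_exp]
      simp only [Complex.add_re, Complex.ofReal_re, Complex.mul_re, Complex.I_re, Complex.I_im,
        Complex.ofReal_im, mul_zero, zero_mul, sub_zero, add_zero]
      rw [hR, Real.exp_log (by linarith)]
      linarith
    have hc : Continuous fun s : ℝ => Θ (z₀, R + s * Complex.I)
        - Complex.log (Q (z₀, R + s * Complex.I) / a) - Complex.log a := by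
      refine (Continuous.sub (hΘ.comp (by fun_prop)) ?_).sub continuous_const
      exact Continuous.clog ((hQc.comp (by fun_prop)).div_const a) fun s => hslit _ (hnorm s)
    have h1 := const_of_exp_eq_one hc (fun s => by
      rw [Complex.exp_sub, Complex.exp_sub, hexp, Complex.exp_log ha,
        Complex.exp_log (div_ne_zero (hQ0 _) ha)]
      have := hQ0 (z₀, R + s * Complex.I)
      field_simp) (2 * π) 0
    have e1 : (R : ℂ) + ((2 * π : ℝ) : ℂ) * Complex.I = (R + (0 : ℝ) * Complex.I)
        + 2 * π * Complex.I := by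
      push_cast
      ring
    have e2 : Q (z₀, R + (0 : ℝ) * Complex.I + 2 * π * Complex.I)
        = Q (z₀, R + (0 : ℝ) * Complex.I) := by
      simp only [hQ, Complex.exp_add _ (2 * π * Complex.I), Complex.exp_two_pi_mul_I, mul_one]
    rw [e1, e2, hper] at h1
    linear_combination h1 / 2
  have hperiod : ∀ z, Function.Periodic (fun t => Θ (z, t)) (2 * π * Complex.I) := by
    intro z t
    simp only [hper, hκ0, mul_zero, add_zero]
  have heq : ∀ z t t', Complex.exp t = Complex.exp t' → Θ (z, t) = Θ (z, t') := by
    intro z t t' htt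
    obtain ⟨n, rfl⟩ := Complex.exp_eq_exp_iff_exists_int.1 htt
    exact (hperiod z).int_mul n t'
  refine ⟨fun p => Θ (p.1, Complex.log (p.2 - p.1)), ?_, ?_, ?_⟩
  · rintro ⟨z₁, w₁⟩ hne
    have hu : w₁ - z₁ ≠ 0 := sub_ne_zero.2 (Ne.symm hne)
    refine ContinuousAt.continuousWithinAt ?_
    have hcont : ContinuousAt (fun p : ℂ × ℂ =>
        Θ (p.1, Complex.log ((p.2 - p.1) / (w₁ - z₁)) + Complex.log (w₁ - z₁))) (z₁, w₁) := by
      refine hΘ.continuousAt.comp (ContinuousAt.prodMk (by fun_prop) ?_)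
      refine ContinuousAt.add (ContinuousAt.clog (by fun_prop) ?_) continuousAt_const
      simp [div_self hu]
    refine hcont.congr ?_
    have hopen : IsOpen {p : ℂ × ℂ | p.1 ≠ p.2} := isOpen_ne_fun continuous_fst continuous_snd
    filter_upwards [hopen.mem_nhds hne] with p hp
    have hp' : p.2 - p.1 ≠ 0 := sub_ne_zero.2 (Ne.symm hp)
    refine heq _ _ _ ?_
    rw [Complex.exp_add, Complex.exp_log (div_ne_zero hp' hu), Complex.exp_log hu,
      Complex.exp_log hp', div_mul_cancel₀ _ hu]
  · intro z w hzw
    have hp' : w - z ≠ 0 := sub_ne_zero.2 (Ne.symm hzw)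
    simp only [hexp, hQ]
    rw [Complex.exp_log hp', add_sub_cancel, ← neg_sub (h z), ← neg_sub z w, neg_div_neg_eq]
  · intro z w
    by_cases hzw : z = w
    · rw [hzw]
    have hp' : w - z ≠ 0 := sub_ne_zero.2 (Ne.symm hzw)
    have hp'' : z - w ≠ 0 := sub_ne_zero.2 hzw
    have h1 := hκ (z, Complex.log (w - z))
    simp only [Complex.exp_log hp', add_sub_cancel, hκ0, add_zero] at h1
    simp only
    rw [← h1]
    refine heq _ _ _ ?_
    rw [Complex.exp_add, Complex.exp_pi_mul_I, Complex.exp_log hp', Complex.exp_log hp'']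
    ring

theorem exists_norm_sub_mul_le (M : ℂ →L[ℝ] ℂ) (hM : 0 < LinearMap.det M.toLinearMap) :
    ∃ a b : ℂ, ‖b‖ < ‖a‖ ∧ ∀ w, M w - a * w = b * (starRingEnd ℂ) w := by
  set p := (M 1).re
  set r := (M 1).im
  set q := (M Complex.I).re
  set s := (M Complex.I).im
  have hdet : LinearMap.det M.toLinearMap = p * s - q * r := by
    rw [← LinearMap.det_toMatrix Complex.basisOneI, Matrix.det_fin_two]
    simp [LinearMap.toMatrix_apply, p, q, r, s]
  have hMw : ∀ w : ℂ, M w = w.re * M 1 + w.im * M Complex.I := by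
    intro w
    have e : w = w.re • (1 : ℂ) + w.im • Complex.I := by
      simp [Complex.re_add_im]
    conv_lhs => rw [e]
    rw [map_add, map_smul, map_smul]
    simp
  refine ⟨⟨(p + s) / 2, (r - q) / 2⟩, ⟨(p - s) / 2, (r + q) / 2⟩, ?_, ?_⟩
  · rw [← sq_lt_sq₀ (norm_nonneg _) (norm_nonneg _), Complex.sq_norm, Complex.sq_norm,
      Complex.normSq_mk, Complex.normSq_mk]
    rw [hdet] at hM
    nlinarith
  · intro w
    rw [hMw]
    apply Complex.ext <;> simp [p, q, r, s] <;> ring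

theorem OrientationPreserving.of_hasFDerivAt {h : ℂ ≃ₜ ℂ} {z₀ : ℂ} {M : ℂ →L[ℝ] ℂ}
    (hM : HasFDerivAt h M z₀) (hdet : 0 < LinearMap.det M.toLinearMap) :
    OrientationPreserving h := by
  obtain ⟨a, b, hab, hw⟩ := exists_norm_sub_mul_le M hdet
  have h1 := (hasFDerivAt_iff_isLittleO_nhds_zero.1 hM).def
    (half_pos (sub_pos.2 hab))
  obtain ⟨ρ, hρ, hb⟩ := Metric.eventually_nhds_iff.1 h1
  refine OrientationPreserving.of_norm_sub_lt (z₀ := z₀) (a := a) hρ fun v hv hvρ => ?_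
  have h2 := hb (y := v) (by simpa using hvρ)
  have h3 : (h (z₀ + v) - h z₀) - a * v = (h (z₀ + v) - h z₀ - M v) + b * (starRingEnd ℂ) v := by
    rw [← hw]
    ring
  have h4 : 0 < ‖v‖ := norm_pos_iff.2 hv
  calc ‖(h (z₀ + v) - h z₀) - a * v‖ ≤ (‖a‖ - ‖b‖) / 2 * ‖v‖ + ‖b‖ * ‖v‖ := by
        rw [h3]
        refine (norm_add_le _ _).trans (add_le_add h2 ?_)
        rw [norm_mul, Complex.norm_conj]
    _ < ‖a‖ * ‖v‖ := by nlinarith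

/-! ### Lifting a disk diffeomorphism fixing the origin to the plane -/

/-- Truncation of a complex number to the closed left half-plane. -/
def leftPart (ζ : ℂ) : ℂ := ⟨min ζ.re 0, ζ.im⟩

theorem continuous_leftPart : Continuous leftPart := by
  have : leftPart = fun ζ => ((min ζ.re 0 : ℝ) : ℂ) + (ζ.im : ℂ) * Complex.I := by
    funext ζ
    exact Complex.mk_eq_add_mul_I _ _
  rw [this]
  exact (Complex.continuous_ofReal.comp (Complex.continuous_re.min continuous_const)).add
    ((Complex.continuous_ofReal.comp Complex.continuous_im).mul continuous_const)

theorem leftPart_of_nonpos {ζ : ℂ} (h : ζ.re ≤ 0) : leftPart ζ = ζ := by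
  apply Complex.ext <;> simp [leftPart, h]

theorem re_leftPart_nonpos (ζ : ℂ) : (leftPart ζ).re ≤ 0 := min_le_right _ _

theorem exp_mem_disk {ζ : ℂ} (h : ζ.re ≤ 0) : Complex.exp ζ ∈ Disk := by
  rw [Disk, mem_closedBall_zero_iff, Complex.norm_exp, Real.exp_le_one_iff]
  exact h

theorem exists_log_lift {f : ℂ → ℂ} (hf : ContinuousOn f Disk) (hm : MapsTo f Disk Disk)
    (h0 : ∀ z ∈ Disk, z ≠ 0 → f z ≠ 0) (hinner : ∀ z, ‖z‖ < 1 → ‖f z‖ < 1) {β : ℝ → ℝ}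
    (hβ : Continuous β) (hβp : ∀ θ, β (θ + 1) = β θ + 1)
    (hβf : ∀ θ : ℝ, f (Complex.exp (2 * π * Complex.I * θ)) =
      Complex.exp (2 * π * Complex.I * β θ)) :
    ∃ L : ℂ → ℂ, Continuous L ∧ (∀ ζ, ζ.re ≤ 0 → Complex.exp (L ζ) = f (Complex.exp ζ)) ∧
      (∀ ζ, L (ζ + 2 * π * Complex.I) = L ζ + 2 * π * Complex.I) ∧
      (∀ θ : ℝ, L (2 * π * Complex.I * θ) = 2 * π * Complex.I * β θ) ∧
      (∀ ζ, ζ.re ≤ 0 → (L ζ).re ≤ 0) ∧ ∀ ζ, ζ.re < 0 → (L ζ).re < 0 := by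
  have hgc : Continuous fun ζ => f (Complex.exp (leftPart ζ)) :=
    hf.comp_continuous (Complex.continuous_exp.comp continuous_leftPart)
      fun ζ => exp_mem_disk (re_leftPart_nonpos ζ)
  have hg0 : ∀ ζ, f (Complex.exp (leftPart ζ)) ≠ 0 := fun ζ =>
    h0 _ (exp_mem_disk (re_leftPart_nonpos ζ)) (Complex.exp_ne_zero _)
  have hre : ∀ θ : ℝ, (2 * π * Complex.I * θ : ℂ).re = 0 := fun θ => by simp
  obtain ⟨L, hL, hexp⟩ := exists_continuous_log hgc hg0
  have hconst : ∀ θ θ' : ℝ, L (2 * π * Complex.I * θ) - 2 * π * Complex.I * β θ =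
      L (2 * π * Complex.I * θ') - 2 * π * Complex.I * β θ' := by
    refine const_of_exp_eq_one
      (c := fun θ : ℝ => L (2 * π * Complex.I * θ) - 2 * π * Complex.I * β θ)
      (by fun_prop) fun θ => ?_
    rw [Complex.exp_sub, hexp, leftPart_of_nonpos (hre θ).le, hβf, div_self (Complex.exp_ne_zero _)]
  set C := L (2 * π * Complex.I * (0 : ℝ)) - 2 * π * Complex.I * β 0 with hC
  have hCexp : Complex.exp C = 1 := by
    rw [hC, Complex.exp_sub, hexp, leftPart_of_nonpos (hre 0).le, hβf,
      div_self (Complex.exp_ne_zero _)]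
  have hbd : ∀ θ : ℝ, L (2 * π * Complex.I * θ) - C = 2 * π * Complex.I * β θ := by
    intro θ
    linear_combination hconst θ 0
  have hexp' : ∀ ζ, ζ.re ≤ 0 → Complex.exp (L ζ - C) = f (Complex.exp ζ) := by
    intro ζ hζ
    rw [Complex.exp_sub, hCexp, div_one, hexp, leftPart_of_nonpos hζ]
  have hnorm : ∀ ζ, ζ.re ≤ 0 → Real.exp (L ζ - C).re = ‖f (Complex.exp ζ)‖ := by
    intro ζ hζ
    rw [← Complex.norm_exp, hexp' ζ hζ]
  refine ⟨fun ζ => L ζ - C, by fun_prop, hexp', fun ζ => ?_, hbd, fun ζ hζ => ?_, fun ζ hζ => ?_⟩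
  · have hc : Continuous fun ζ => L (ζ + 2 * π * Complex.I) - L ζ - 2 * π * Complex.I := by
      fun_prop
    have h1 := const_of_exp_eq_one hc (fun ζ => by
      have e : Complex.exp (leftPart (ζ + 2 * π * Complex.I)) = Complex.exp (leftPart ζ) := by
        have : leftPart (ζ + 2 * π * Complex.I) = leftPart ζ + 2 * π * Complex.I := by
          apply Complex.ext <;> simp [leftPart]
        rw [this, Complex.exp_add, Complex.exp_two_pi_mul_I, mul_one]
      rw [Complex.exp_sub, Complex.exp_sub, Complex.exp_two_pi_mul_I, hexp, hexp, e,
        div_self (hg0 ζ), div_one]) ζ (2 * π * Complex.I * (0 : ℝ))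
    have h2 := hbd 0
    have h3 := hbd (0 + 1)
    rw [hβp] at h3
    push_cast at h1 h2 h3
    simp only [mul_zero, zero_add, mul_one] at h1 h2 h3
    linear_combination h1 + h3 - h2
  · rw [← Real.exp_le_one_iff, hnorm ζ hζ]
    exact mem_closedBall_zero_iff.1 (hm (exp_mem_disk hζ))
  · rw [← Real.exp_lt_one_iff, hnorm ζ hζ.le]
    refine hinner _ ?_
    rw [Complex.norm_exp, Real.exp_lt_one_iff]
    exact hζ

/-- A diffeomorphism from the plane onto the open left half-plane commuting with the vertical
translations. -/
def toLeft (w : ℂ) : ℂ := ⟨-Real.exp (-w.re), w.im⟩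

/-- The inverse of `toLeft`. -/
def ofLeft (ζ : ℂ) : ℂ := ⟨-Real.log (-ζ.re), ζ.im⟩

theorem re_toLeft_neg (w : ℂ) : (toLeft w).re < 0 := neg_neg_of_pos (Real.exp_pos _)

theorem ofLeft_toLeft (w : ℂ) : ofLeft (toLeft w) = w := by
  apply Complex.ext <;> simp [ofLeft, toLeft]

theorem toLeft_ofLeft {ζ : ℂ} (h : ζ.re < 0) : toLeft (ofLeft ζ) = ζ := by
  apply Complex.ext <;> simp [ofLeft, toLeft, Real.exp_log_of_neg h]

theorem toLeft_add (w : ℂ) : toLeft (w + 2 * π * Complex.I) = toLeft w + 2 * π * Complex.I := by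
  apply Complex.ext <;> simp [toLeft]

theorem ofLeft_add (w : ℂ) : ofLeft (w + 2 * π * Complex.I) = ofLeft w + 2 * π * Complex.I := by
  apply Complex.ext <;> simp [ofLeft]

theorem toLeft_eq (w : ℂ) : toLeft w = ((-Real.exp (-w.re) : ℝ) : ℂ) + (w.im : ℂ) * Complex.I :=
  Complex.mk_eq_add_mul_I _ _

theorem ofLeft_eq (w : ℂ) : ofLeft w = ((-Real.log (-w.re) : ℝ) : ℂ) + (w.im : ℂ) * Complex.I :=
  Complex.mk_eq_add_mul_I _ _

theorem continuous_toLeft : Continuous toLeft := by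
  rw [funext toLeft_eq]
  fun_prop

theorem hasFDerivAt_toLeft_zero : HasFDerivAt toLeft (ContinuousLinearMap.id ℝ ℂ) 0 := by
  have h1 : HasFDerivAt (fun w : ℂ => w.re) Complex.reCLM 0 := Complex.reCLM.hasFDerivAt
  have h2 : HasFDerivAt (fun w : ℂ => w.im) Complex.imCLM 0 := Complex.imCLM.hasFDerivAt
  have h3 := Complex.ofRealCLM.hasFDerivAt.comp (0 : ℂ) h1.neg.exp.neg
  have h4 := (Complex.ofRealCLM.hasFDerivAt.comp (0 : ℂ) h2).mul_const Complex.I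
  rw [funext toLeft_eq]
  refine (h3.add h4).congr_fderiv ?_
  ext w
  simpa [mul_comm] using Complex.re_add_im w

theorem hasFDerivAt_ofLeft {ζ : ℂ} (h : ζ.re < 0) :
    ∃ M : ℂ →L[ℝ] ℂ, HasFDerivAt ofLeft M ζ ∧ 0 < LinearMap.det M.toLinearMap := by
  have h1 : HasFDerivAt (fun w : ℂ => w.re) Complex.reCLM ζ := Complex.reCLM.hasFDerivAt
  have h2 : HasFDerivAt (fun w : ℂ => w.im) Complex.imCLM ζ := Complex.imCLM.hasFDerivAt
  have h3 := Complex.ofRealCLM.hasFDerivAt.comp ζ (h1.neg.log (by simpa using h.ne)).neg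
  have h4 := (Complex.ofRealCLM.hasFDerivAt.comp ζ h2).mul_const Complex.I
  refine ⟨_, (h3.add h4).congr_of_eventuallyEq (.of_forall ofLeft_eq), ?_⟩
  rw [← LinearMap.det_toMatrix Complex.basisOneI, Matrix.det_fin_two]
  simp [LinearMap.toMatrix_apply, h]

theorem continuousAt_ofLeft {ζ : ℂ} (h : ζ.re < 0) : ContinuousAt ofLeft ζ := by
  obtain ⟨M, hM, -⟩ := hasFDerivAt_ofLeft h
  exact hM.continuousAt

theorem det_mulLeft (a : ℂ) :
    LinearMap.det (ContinuousLinearMap.mul ℝ ℂ a).toLinearMap = Complex.normSq a := by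
  rw [← LinearMap.det_toMatrix Complex.basisOneI, Matrix.det_fin_two]
  simp [LinearMap.toMatrix_apply, Complex.normSq_apply]

theorem exists_eq_exp_of_norm_eq_one {z : ℂ} (hz : ‖z‖ = 1) :
    ∃ θ : ℝ, z = Complex.exp (2 * π * Complex.I * θ) := by
  refine ⟨z.arg / (2 * π), ?_⟩
  have h := Complex.norm_mul_exp_arg_mul_I z
  rw [hz, Complex.ofReal_one, one_mul] at h
  conv_lhs => rw [← h]
  congr 1
  push_cast
  field_simp

theorem norm_exp_two_pi (θ : ℝ) : ‖Complex.exp (2 * π * Complex.I * θ)‖ = 1 := by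
  rw [Complex.norm_exp]
  simp

theorem surjective_of_add_one {β : ℝ → ℝ} (hβ : Continuous β)
    (hβp : ∀ θ, β (θ + 1) = β θ + 1) : Function.Surjective β := by
  have h1 : ∀ n : ℕ, β n = β 0 + n := by
    intro n
    induction n with
    | zero => simp
    | succ n ih => push_cast; rw [hβp, ih, add_assoc]
  have h2 : ∀ n : ℕ, β (-n) = β 0 - n := by
    intro n
    induction n with
    | zero => simp
    | succ n ih =>
      have := hβp (-(n + 1 : ℕ))
      rw [show -((n + 1 : ℕ) : ℝ) + 1 = -n by push_cast; ring, ih] at this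
      push_cast at this ⊢
      linarith
  intro y
  obtain ⟨n, hn⟩ := exists_nat_ge (|y - β 0|)
  have h3 := abs_le.1 hn
  obtain ⟨x, -, hx⟩ := intermediate_value_Icc (a := -(n : ℝ)) (b := n)
    (by linarith [n.cast_nonneg (α := ℝ)]) hβ.continuousOn
    (show y ∈ Icc (β (-n)) (β n) by rw [h1, h2]; constructor <;> linarith)
  exact ⟨x, hx⟩

namespace SympDiff

variable (f : SympDiff)

theorem injOn : InjOn f.toFun Disk := fun z hz w hw h => by
  rw [← f.left_inv z hz, h, f.left_inv w hw]

theorem mem_disk_of_norm_eq_one {z : ℂ} (hz : ‖z‖ = 1) : z ∈ Disk :=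
  mem_closedBall_zero_iff.2 hz.le

theorem norm_lt_one {lift : ℝ → ℝ} (hlift : Function.Surjective lift)
    (hproj : ∀ θ : ℝ, f.toFun (Complex.exp (2 * π * Complex.I * θ)) =
      Complex.exp (2 * π * Complex.I * lift θ)) {z : ℂ} (hz : ‖z‖ < 1) : ‖f.toFun z‖ < 1 := by
  have hzD : z ∈ Disk := mem_closedBall_zero_iff.2 hz.le
  refine lt_of_le_of_ne (mem_closedBall_zero_iff.1 (f.mapsTo hzD)) fun h => ?_
  obtain ⟨t, ht⟩ := exists_eq_exp_of_norm_eq_one h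
  obtain ⟨θ, rfl⟩ := hlift t
  rw [← hproj] at ht
  have h1 := f.injOn hzD (mem_disk_of_norm_eq_one (norm_exp_two_pi θ)) ht
  rw [h1, norm_exp_two_pi] at hz
  exact lt_irrefl _ hz

theorem inv_norm_lt_one {lift : ℝ → ℝ}
    (hproj : ∀ θ : ℝ, f.toFun (Complex.exp (2 * π * Complex.I * θ)) =
      Complex.exp (2 * π * Complex.I * lift θ)) {z : ℂ} (hz : ‖z‖ < 1) : ‖f.invFun z‖ < 1 := by
  have hzD : z ∈ Disk := mem_closedBall_zero_iff.2 hz.le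
  refine lt_of_le_of_ne (mem_closedBall_zero_iff.1 (f.inv_mapsTo hzD)) fun h => ?_
  obtain ⟨t, ht⟩ := exists_eq_exp_of_norm_eq_one h
  have h1 := f.right_inv z hzD
  rw [ht, hproj] at h1
  rw [← h1, norm_exp_two_pi] at hz
  exact lt_irrefl _ hz

theorem hasFDerivAt {z : ℂ} (hz : ‖z‖ < 1) :
    HasFDerivAt f.toFun (fderivWithin ℝ f.toFun Disk z) z := by
  have hzD : z ∈ Disk := mem_closedBall_zero_iff.2 hz.le
  refine ((f.contDiffOn.differentiableOn one_ne_zero) z hzD).hasFDerivWithinAt.hasFDerivAt ?_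
  exact mem_of_superset (isOpen_ball.mem_nhds (mem_ball_zero_iff.2 hz)) ball_subset_closedBall

end SympDiff

theorem hasFDerivAt_of_exp_eq {f L : ℂ → ℂ} {M : ℂ →L[ℝ] ℂ} {ζ : ℂ} (hL : ContinuousAt L ζ)
    (hexp : ∀ᶠ x in 𝓝 ζ, Complex.exp (L x) = f (Complex.exp x))
    (hM : HasFDerivAt f M (Complex.exp ζ)) (hdet : 0 < LinearMap.det M.toLinearMap) :
    ∃ M' : ℂ →L[ℝ] ℂ, HasFDerivAt L M' ζ ∧ 0 < LinearMap.det M'.toLinearMap := by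
  have hE : HasFDerivAt Complex.exp (ContinuousLinearMap.mul ℝ ℂ (Complex.exp ζ)) ζ :=
    ((Complex.hasDerivAt_exp ζ).hasFDerivAt.restrictScalars ℝ).congr_fderiv (by
      ext w
      simp [mul_comm])
  have hlog : HasFDerivAt (fun w => Complex.log (w / Complex.exp (L ζ)) + L ζ)
      (ContinuousLinearMap.mul ℝ ℂ (Complex.exp (L ζ))⁻¹) (f (Complex.exp ζ)) := by
    have h1 : HasDerivAt (fun w : ℂ => w / Complex.exp (L ζ)) (1 / Complex.exp (L ζ))
        (f (Complex.exp ζ)) := (hasDerivAt_id _).div_const _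
    have e : f (Complex.exp ζ) / Complex.exp (L ζ) = 1 := by
      rw [← hexp.self_of_nhds, div_self (Complex.exp_ne_zero _)]
    have h2 := (h1.clog (by rw [e]; simp)).add_const (L ζ)
    refine (h2.hasFDerivAt.restrictScalars ℝ).congr_fderiv ?_
    ext w
    simp [e, mul_comm]
  refine ⟨_, ((hlog.comp _ hM).comp ζ hE).congr_of_eventuallyEq ?_, ?_⟩
  · have h1 : ∀ᶠ x in 𝓝 ζ, ‖L x - L ζ‖ < π := by
      have h2 : Tendsto (fun x => ‖L x - L ζ‖) (𝓝 ζ) (𝓝 0) := by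
        have := (hL.tendsto.sub_const (L ζ)).norm
        simpa using this
      exact h2.eventually_lt_const Real.pi_pos
    filter_upwards [hexp, h1] with x hx hx1
    have h3 := abs_lt.1 ((Complex.abs_im_le_norm _).trans_lt hx1)
    simp only [Function.comp_apply]
    rw [← hx, ← Complex.exp_sub, Complex.log_exp h3.1 h3.2.le, sub_add_cancel]
  · have e : ∀ P Q : ℂ →L[ℝ] ℂ, LinearMap.det (P.comp Q).toLinearMap =
        LinearMap.det P.toLinearMap * LinearMap.det Q.toLinearMap := fun P Q =>
      LinearMap.det_comp _ _
    rw [e, e, det_mulLeft, det_mulLeft]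
    have h1 : 0 < Complex.normSq (Complex.exp (L ζ))⁻¹ :=
      Complex.normSq_pos.2 (inv_ne_zero (Complex.exp_ne_zero _))
    have h2 : 0 < Complex.normSq (Complex.exp ζ) := Complex.normSq_pos.2 (Complex.exp_ne_zero _)
    positivity

/-- A lift `F` to the plane of a symplectic diffeomorphism of the disk fixing the origin, seen in
the coordinate `toLeft`, and its continuous extension `L` to the boundary. -/
structure IsPlaneLift (f : SympDiff) (lift : ℝ → ℝ) (F : ℂ ≃ₜ ℂ) (L : ℂ → ℂ) : Prop where
  orientationPreserving : OrientationPreserving F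
  add : ∀ w, F (w + 2 * π * Complex.I) = F w + 2 * π * Complex.I
  continuous : Continuous L
  boundary : ∀ θ : ℝ, L (2 * π * Complex.I * θ) = 2 * π * Complex.I * lift θ
  toLeft_eq : ∀ w, toLeft (F w) = L (toLeft w)
  exp_eq : ∀ w, Complex.exp (toLeft (F w)) = f.toFun (Complex.exp (toLeft w))

/-- A symplectic diffeomorphism of the disk fixing the origin lifts to an orientation preserving
homeomorphism of the plane, the universal covering of the open disk without the origin. -/
theorem SympDiff.exists_plane_lift (f : SympDiff) (hfix : f.toFun 0 = 0) {lift : ℝ → ℝ}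
    (hlift_cont : Continuous lift) (hlift_mono : StrictMono lift)
    (hlift_per : ∀ θ : ℝ, lift (θ + 1) = lift θ + 1)
    (hproj : ∀ θ : ℝ, f.toFun (Complex.exp (2 * π * Complex.I * θ)) =
      Complex.exp (2 * π * Complex.I * lift θ)) :
    ∃ (F : ℂ ≃ₜ ℂ) (L : ℂ → ℂ), IsPlaneLift f lift F L := by
  have h0D : (0 : ℂ) ∈ Disk := mem_closedBall_zero_iff.2 (by simp)
  have hsurj := surjective_of_add_one hlift_cont hlift_per
  set e : ℝ ≃o ℝ := hlift_mono.orderIsoOfSurjective lift hsurj with he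
  have hel : ∀ θ, e θ = lift θ := fun θ => rfl
  obtain ⟨L, hL, Lexp, Ladd, Lbd, Lle, Llt⟩ := exists_log_lift f.contDiffOn.continuousOn f.mapsTo
    (fun z hz hz0 h => hz0 (f.injOn hz h0D (h.trans hfix.symm)))
    (fun z hz => f.norm_lt_one hsurj hproj hz) hlift_cont hlift_per hproj
  obtain ⟨K, hK, Kexp, Kadd, Kbd, Kle, Klt⟩ := exists_log_lift f.inv_contDiffOn.continuousOn
    f.inv_mapsTo
    (fun z hz hz0 h => hz0 (by rw [← f.right_inv z hz, h, hfix]))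
    (fun z hz => f.inv_norm_lt_one hproj hz) e.symm.continuous
    (fun θ => by
      rw [OrderIso.symm_apply_eq, hel, hlift_per, ← hel, e.apply_symm_apply])
    (fun θ => by
      have := hproj (e.symm θ)
      rw [← hel, e.apply_symm_apply] at this
      rw [← this, f.left_inv _ (SympDiff.mem_disk_of_norm_eq_one (norm_exp_two_pi _))])
  have KL : ∀ ζ, ζ.re ≤ 0 → K (L ζ) = ζ := by
    intro ζ hζ
    have hc : Continuous fun ζ => K (L (leftPart ζ)) - leftPart ζ :=
      (hK.comp (hL.comp continuous_leftPart)).sub continuous_leftPart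
    have h1 := const_of_exp_eq_one hc (fun ζ => by
      have hr := re_leftPart_nonpos ζ
      rw [Complex.exp_sub, Kexp _ (Lle _ hr), Lexp _ hr, f.left_inv _ (exp_mem_disk hr),
        div_self (Complex.exp_ne_zero _)]) ζ (2 * π * Complex.I * (0 : ℝ))
    rw [leftPart_of_nonpos hζ, leftPart_of_nonpos (by simp), Lbd, Kbd, ← hel,
      e.symm_apply_apply, sub_self] at h1
    exact sub_eq_zero.1 h1
  have LK : ∀ ζ, ζ.re ≤ 0 → L (K ζ) = ζ := by
    intro ζ hζ
    have hc : Continuous fun ζ => L (K (leftPart ζ)) - leftPart ζ :=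
      (hL.comp (hK.comp continuous_leftPart)).sub continuous_leftPart
    have h1 := const_of_exp_eq_one hc (fun ζ => by
      have hr := re_leftPart_nonpos ζ
      rw [Complex.exp_sub, Lexp _ (Kle _ hr), Kexp _ hr, f.right_inv _ (exp_mem_disk hr),
        div_self (Complex.exp_ne_zero _)]) ζ (2 * π * Complex.I * (0 : ℝ))
    rw [leftPart_of_nonpos hζ, leftPart_of_nonpos (by simp), Kbd, Lbd, ← hel,
      e.apply_symm_apply, sub_self] at h1
    exact sub_eq_zero.1 h1
  have hLt : ∀ w, toLeft (ofLeft (L (toLeft w))) = L (toLeft w) := fun w =>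
    toLeft_ofLeft (Llt _ (re_toLeft_neg w))
  have hKt : ∀ w, toLeft (ofLeft (K (toLeft w))) = K (toLeft w) := fun w =>
    toLeft_ofLeft (Klt _ (re_toLeft_neg w))
  let F : ℂ ≃ₜ ℂ :=
    { toFun := fun w => ofLeft (L (toLeft w))
      invFun := fun w => ofLeft (K (toLeft w))
      left_inv := fun w => by
        simp only [hLt, KL _ (re_toLeft_neg w).le, ofLeft_toLeft]
      right_inv := fun w => by
        simp only [hKt, LK _ (re_toLeft_neg w).le, ofLeft_toLeft]
      continuous_toFun := continuous_iff_continuousAt.2 fun w =>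
        (continuousAt_ofLeft (Llt _ (re_toLeft_neg w))).comp (f := fun w => L (toLeft w))
          (hL.comp continuous_toLeft).continuousAt
      continuous_invFun := continuous_iff_continuousAt.2 fun w =>
        (continuousAt_ofLeft (Klt _ (re_toLeft_neg w))).comp (f := fun w => K (toLeft w))
          (hK.comp continuous_toLeft).continuousAt }
  have hF : ∀ w, F w = ofLeft (L (toLeft w)) := fun w => rfl
  refine ⟨F, L, ?_, fun w => ?_, hL, Lbd, fun w => ?_, fun w => ?_⟩
  · have hre : (toLeft 0).re < 0 := re_toLeft_neg 0
    have hnorm : ‖Complex.exp (toLeft 0)‖ < 1 := by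
      rw [Complex.norm_exp, Real.exp_lt_one_iff]
      exact hre
    obtain ⟨M, hM, hMd⟩ := hasFDerivAt_of_exp_eq hL.continuousAt
      (by
        filter_upwards [(isOpen_lt Complex.continuous_re continuous_const).mem_nhds hre]
          with x hx
        exact Lexp x (le_of_lt hx))
      (f.hasFDerivAt hnorm)
      (by rw [f.jacobian _ (mem_closedBall_zero_iff.2 hnorm.le)]; exact one_pos)
    obtain ⟨N, hN, hNd⟩ := hasFDerivAt_ofLeft (Llt _ hre)
    refine OrientationPreserving.of_hasFDerivAt (z₀ := 0) (M := N.comp M) ?_ ?_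
    · have := (hN.comp _ hM).comp (0 : ℂ) hasFDerivAt_toLeft_zero
      rw [ContinuousLinearMap.comp_id] at this
      exact this
    · have e : LinearMap.det (N.comp M).toLinearMap =
        LinearMap.det N.toLinearMap * LinearMap.det M.toLinearMap := LinearMap.det_comp _ _
      rw [e]
      positivity
  · rw [hF, hF, toLeft_add, Ladd, ofLeft_add]
  · rw [hF, hLt]
  · rw [hF, hLt, Lexp _ (re_toLeft_neg w).le]

/-! ### Invariance of the Lebesgue measure -/

namespace SympDiff

variable (f : SympDiff)

/-- The extension of a disk diffeomorphism by the identity. -/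
def ext : ℂ → ℂ := open Classical in Disk.piecewise f.toFun id

theorem ext_of_mem {z : ℂ} (hz : z ∈ Disk) : f.ext z = f.toFun z := by
  classical exact Set.piecewise_eq_of_mem _ _ _ hz

theorem iterate_mem {z : ℂ} (hz : z ∈ Disk) (n : ℕ) : f.toFun^[n] z ∈ Disk :=
  f.mapsTo.iterate n hz

theorem ext_iterate {z : ℂ} (hz : z ∈ Disk) (n : ℕ) : f.ext^[n] z = f.toFun^[n] z := by
  induction n with
  | zero => rfl
  | succ n ih =>
    rw [Function.iterate_succ_apply', ih, f.ext_of_mem (f.iterate_mem hz n),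
      Function.iterate_succ_apply']

theorem measurable_ext : Measurable f.ext := by
  classical
  have hD : MeasurableSet Disk := isClosed_closedBall.measurableSet
  refine measurable_of_restrict_of_restrict_compl hD ?_ ?_
  · have : Disk.domRestrict f.ext = Disk.domRestrict f.toFun := by
      ext z
      exact f.ext_of_mem z.2
    rw [this]
    exact f.contDiffOn.continuousOn.domRestrict.measurable
  · have : Diskᶜ.domRestrict f.ext = Subtype.val := by
      ext z
      exact Set.piecewise_eq_of_notMem _ _ _ z.2
    rw [this]
    exact measurable_subtype_coe

theorem measurePreserving_ext :
    MeasurePreserving f.ext (volume.restrict Disk) (volume.restrict Disk) := by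
  refine ⟨f.measurable_ext, ?_⟩
  have hD : MeasurableSet Disk := isClosed_closedBall.measurableSet
  have heq : EqOn f.ext f.toFun Disk := fun z hz => f.ext_of_mem hz
  have h1 : ∀ z ∈ Disk, HasFDerivWithinAt f.ext (fderivWithin ℝ f.toFun Disk z) Disk z :=
    fun z hz => ((f.contDiffOn.differentiableOn one_ne_zero) z hz).hasFDerivWithinAt.congr heq
      (heq hz)
  have himg : f.ext '' Disk = Disk := by
    rw [heq.image_eq]
    refine Subset.antisymm f.mapsTo.image_subset fun z hz => ⟨f.invFun z, f.inv_mapsTo hz, ?_⟩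
    exact f.right_inv z hz
  have h2 := map_withDensity_abs_det_fderiv_eq_addHaar volume hD.nullMeasurableSet h1
    (heq.injOn_iff.2 f.injOn)
  rw [himg] at h2
  have h3 : (fun z => ENNReal.ofReal |(fderivWithin ℝ f.toFun Disk z).det|)
      =ᵐ[volume.restrict Disk] 1 := by
    filter_upwards [ae_restrict_mem hD] with z hz
    have := f.jacobian z hz
    rw [ContinuousLinearMap.det, this]
    simp
  rwa [withDensity_congr_ae h3, withDensity_one] at h2

instance : IsFiniteMeasure (volume.restrict Disk) :=
  ⟨by rw [Measure.restrict_apply_univ]; exact (isCompact_closedBall _ _).measure_lt_top⟩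

end SympDiff

/-! ### The universal covering of the punctured disk -/

/-- The universal covering of the punctured open disk. -/
def cover (w : ℂ) : ℂ := Complex.exp (toLeft w)

theorem norm_cover_lt (w : ℂ) : ‖cover w‖ < 1 := by
  rw [cover, Complex.norm_exp, Real.exp_lt_one_iff]
  exact re_toLeft_neg w

theorem cover_mem (w : ℂ) : cover w ∈ Disk := mem_closedBall_zero_iff.2 (norm_cover_lt w).le

theorem cover_ne_zero (w : ℂ) : cover w ≠ 0 := Complex.exp_ne_zero _

theorem continuous_cover : Continuous cover := Complex.continuous_exp.comp continuous_toLeft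

theorem cover_eq_iff {w w' : ℂ} : cover w = cover w' ↔ ∃ j : ℤ, w = w' + j * (2 * π * Complex.I) := by
  rw [cover, cover, Complex.exp_eq_exp_iff_exists_int]
  refine exists_congr fun j => ?_
  have h1 : toLeft (w' + j * (2 * π * Complex.I)) = toLeft w' + j * (2 * π * Complex.I) := by
    have := iterate_add_mul toLeft_add 1 w' j
    simpa using this
  rw [← h1]
  constructor
  · intro h
    rw [← ofLeft_toLeft w, h, ofLeft_toLeft]
  · rintro rfl
    rfl

theorem isOpenMap_cover : IsOpenMap cover := by
  have h1 : IsOpenMap toLeft := by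
    intro U hU
    have h2 : toLeft '' U = {ζ | ζ.re < 0} ∩ ofLeft ⁻¹' U := by
      ext ζ
      constructor
      · rintro ⟨w, hw, rfl⟩
        exact ⟨re_toLeft_neg w, by rwa [mem_preimage, ofLeft_toLeft]⟩
      · rintro ⟨h, hζ⟩
        exact ⟨_, hζ, toLeft_ofLeft h⟩
    rw [h2]
    exact ContinuousOn.isOpen_inter_preimage
      (fun ζ hζ => (continuousAt_ofLeft hζ).continuousWithinAt)
      (isOpen_lt Complex.continuous_re continuous_const) hU
  exact Complex.isOpenMap_exp.comp h1

namespace IsPlaneLift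

variable {f : SympDiff} {lift : ℝ → ℝ} {F : ℂ ≃ₜ ℂ} {L : ℂ → ℂ}

theorem cover_iterate (hF : IsPlaneLift f lift F L) (n : ℕ) (w : ℂ) :
    cover (F^[n] w) = f.toFun^[n] (cover w) := by
  induction n with
  | zero => rfl
  | succ n ih =>
    rw [Function.iterate_succ_apply', Function.iterate_succ_apply', ← ih]
    exact hF.exp_eq _

theorem toLeft_iterate (hF : IsPlaneLift f lift F L) (n : ℕ) (w : ℂ) :
    toLeft (F^[n] w) = L^[n] (toLeft w) := by
  induction n with
  | zero => rfl
  | succ n ih =>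
    rw [Function.iterate_succ_apply', Function.iterate_succ_apply', ← ih]
    exact hF.toLeft_eq _

theorem boundary_iterate (hF : IsPlaneLift f lift F L) (n : ℕ) (θ : ℝ) :
    L^[n] (2 * π * Complex.I * θ) = 2 * π * Complex.I * (lift^[n] θ : ℝ) := by
  induction n with
  | zero => rfl
  | succ n ih =>
    rw [Function.iterate_succ_apply', Function.iterate_succ_apply', ih, hF.boundary]

/-- The homeomorphism `F^m` followed by a deck transformation. -/
theorem exists_brouwer (hF : IsPlaneLift f lift F L)
    (hpseudo : ∀ z ∈ Disk, z ≠ 0 → ∀ n : ℕ, 1 ≤ n → f.toFun^[n] z ≠ z) {m : ℕ} (hm : 1 ≤ m)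
    (p : ℤ) :
    ∃ h : ℂ ≃ₜ ℂ, IsBrouwer h ∧ (∀ w, h (w + 2 * π * Complex.I) = h w + 2 * π * Complex.I) ∧
      ∀ n w, h^[n] w = F^[m * n] w - (n * p : ℤ) * (2 * π * Complex.I) := by
  have key : ∀ m : ℕ, ∃ h : ℂ ≃ₜ ℂ, OrientationPreserving h ∧ ∀ w, h w = F^[m] w := by
    intro m
    induction m with
    | zero => exact ⟨Homeomorph.refl ℂ, .refl, fun w => rfl⟩
    | succ m ih =>
      obtain ⟨h, ho, hh⟩ := ih
      refine ⟨h.trans F, ho.trans hF.1, fun w => ?_⟩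
      rw [Homeomorph.trans_apply, hh, Function.iterate_succ_apply']
  obtain ⟨h, ho, hh⟩ := key m
  have hadd : ∀ n w (j : ℤ), F^[n] (w + j * (2 * π * Complex.I)) =
      F^[n] w + j * (2 * π * Complex.I) := iterate_add_mul hF.add
  have h1 : ∀ w, (h.trans (Homeomorph.addRight (-(p * (2 * π * Complex.I))))) w =
      F^[m] w - p * (2 * π * Complex.I) := by
    intro w
    rw [Homeomorph.trans_apply, hh, Homeomorph.coe_addRight, sub_eq_add_neg]
  refine ⟨h.trans (Homeomorph.addRight (-(p * (2 * π * Complex.I)))),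
    ⟨ho.trans (orientationPreserving_translation _), fun z hz => ?_⟩, fun w => ?_, fun n => ?_⟩
  · rw [h1, sub_eq_iff_eq_add] at hz
    have h2 := cover_eq_iff.2 ⟨p, hz⟩
    rw [hF.cover_iterate] at h2
    exact hpseudo _ (cover_mem z) (cover_ne_zero z) m hm h2
  · have := hadd m w 1
    simp only [Int.cast_one, one_mul] at this
    rw [h1, h1, this]
    ring
  · induction n with
    | zero => simp
    | succ n ih =>
      intro w
      have e : F^[m * n] w - (n * p : ℤ) * (2 * π * Complex.I) =
          F^[m * n] w + (-(n * p) : ℤ) * (2 * π * Complex.I) := by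
        push_cast
        ring
      rw [Function.iterate_succ_apply', ih, h1, mul_add_one, add_comm, Function.iterate_add_apply,
        e, hadd]
      push_cast
      ring

theorem exists_return (hF : IsPlaneLift f lift F L) (m : ℕ) {U : Set ℂ} (hU : IsOpen U)
    (hne : U.Nonempty) :
    ∃ y ∈ U, ∃ n ≥ 1, ∃ k : ℤ, F^[m * n] y - k * (2 * π * Complex.I) ∈ U := by
  have hsub : cover '' U ⊆ Disk := by
    rintro _ ⟨w, -, rfl⟩
    exact cover_mem w
  have hopen : IsOpen (cover '' U) := isOpenMap_cover U hU
  have hcons := (f.measurePreserving_ext.iterate m).conservative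
  obtain ⟨_, ⟨y, hy, rfl⟩, n, hn, hn'⟩ := hcons.exists_mem_iterate_mem
    hopen.measurableSet.nullMeasurableSet (by
      rw [Measure.restrict_apply hopen.measurableSet, inter_eq_left.2 hsub]
      exact (hopen.measure_pos _ (hne.image _)).ne')
  rw [← Function.iterate_mul, f.ext_iterate (cover_mem y), ← hF.cover_iterate] at hn'
  obtain ⟨u, hu, hu'⟩ := hn'
  obtain ⟨j, hj⟩ := cover_eq_iff.1 hu'
  refine ⟨y, hy, n, by omega, -j, ?_⟩
  convert hu using 1
  rw [hj]
  push_cast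
  ring

end IsPlaneLift

/-! ### Comparing the returns to tiles with the boundary rotation number -/

theorem IsTile.mono {c : ℂ} {h : ℂ → ℂ} {U V : Set ℂ} (hU : IsTile c h U) (hV : IsOpen V)
    (hV' : IsPreconnected V) (hVU : V ⊆ U) : IsTile c h V :=
  ⟨hV, hV', fun z hz j hj => hU.3 z (hVU hz) j (hVU hj),
    fun z hz j hj => hU.4 z (hVU hz) j (hVU hj)⟩

theorem exists_isTile_ball {h : ℂ → ℂ} (hh : Continuous h) {x : ℂ}
    (hx : ∀ j : ℤ, h x ≠ x + j * (2 * π * Complex.I)) :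
    ∃ δ > 0, IsTile (2 * π * Complex.I) h (ball x δ) := by
  have h1 : ∀ᶠ q : ℂ × ℂ in 𝓝 (x, x), Complex.exp (h q.1 - q.2) ≠ 1 := by
    have : Continuous fun q : ℂ × ℂ => Complex.exp (h q.1 - q.2) := by fun_prop
    refine this.continuousAt.eventually_ne ?_
    rw [Ne, Complex.exp_eq_one_iff]
    rintro ⟨j, hj⟩
    exact hx j (by linear_combination hj)
  obtain ⟨δ, hδ, hb⟩ := Metric.eventually_nhds_iff_ball.1 h1
  refine ⟨min δ 1, by positivity, isOpen_ball, (convex_ball _ _).isPreconnected, ?_, ?_⟩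
  · intro z hz j hj
    by_contra hj0
    have h2 : dist z (z - j * (2 * π * Complex.I)) < 2 := by
      have h3 := (mem_ball.1 hz).trans_le (min_le_right _ _)
      have h4 := (mem_ball'.1 hj).trans_le (min_le_right _ _)
      linarith [dist_triangle z x (z - j * (2 * π * Complex.I))]
    rw [dist_eq_norm, sub_sub_cancel, norm_mul, norm_mul, norm_mul, Complex.norm_I,
      Complex.norm_intCast, Complex.norm_real, Real.norm_of_nonneg Real.pi_pos.le] at h2
    have h5 : (1 : ℝ) ≤ |(j : ℝ)| := by exact_mod_cast Int.one_le_abs hj0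
    simp only [Complex.norm_ofNat, mul_one] at h2
    nlinarith [Real.pi_gt_three]
  · intro z hz j hj
    refine hb (z, h z - j * (2 * π * Complex.I)) ?_ ?_
    · rw [← ball_prod_same]
      exact ⟨ball_subset_ball (min_le_left _ _) hz, ball_subset_ball (min_le_left _ _) hj⟩
    · simp only [sub_sub_cancel]
      exact Complex.exp_int_mul_two_pi_mul_I j

/-- The returns to any two tiles have the same sign. -/
theorem IsBrouwer.pos_of_return {h : ℂ ≃ₜ ℂ} (hh : IsBrouwer h) {c : ℂ}
    (hc : ∀ z, h (z + c) = h z + c) (hsmall : ∀ x, ∃ δ > 0, IsTile c h (ball x δ))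
    (hret : ∀ U : Set ℂ, IsOpen U → U.Nonempty →
      ∃ y ∈ U, ∃ n ≥ 1, ∃ k : ℤ, h^[n] y - k * c ∈ U)
    {U U' : Set ℂ} (hU : IsTile c h U) (hU' : IsTile c h U')
    {y y' : ℂ} {n n' : ℕ} {k k' : ℤ} (hn : 1 ≤ n) (hn' : 1 ≤ n') (hy : y ∈ U) (hy' : y' ∈ U')
    (hk : h^[n] y - k * c ∈ U) (hk' : h^[n'] y' - k' * c ∈ U') (hk0 : 0 ≤ k) : 0 < k' := by
  set P : Set ℂ := {x | ∃ U, IsTile c h U ∧ x ∈ U ∧ ∃ y ∈ U, ∃ n ≥ 1, ∃ k : ℤ,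
    h^[n] y - k * c ∈ U ∧ 0 ≤ k} with hP
  set N : Set ℂ := {x | ∃ U, IsTile c h U ∧ x ∈ U ∧ ∃ y ∈ U, ∃ n ≥ 1, ∃ k : ℤ,
    h^[n] y - k * c ∈ U ∧ k ≤ 0} with hN
  have hPo : IsOpen P := isOpen_iff_forall_mem_open.2 fun x ⟨U, hU, hx, hr⟩ =>
    ⟨U, fun z hz => ⟨U, hU, hz, hr⟩, hU.1, hx⟩
  have hNo : IsOpen N := isOpen_iff_forall_mem_open.2 fun x ⟨U, hU, hx, hr⟩ =>
    ⟨U, fun z hz => ⟨U, hU, hz, hr⟩, hU.1, hx⟩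
  have hdisj : ∀ x ∈ P, x ∉ N := by
    rintro x ⟨U, hU, hx, y, hy, n, hn, k, hk, hk0⟩ ⟨V, hV, hx', y', hy', n', hn', k', hk', hk0'⟩
    obtain ⟨z, hz, i, hi, l, hl⟩ := hret (U ∩ V) (hU.1.inter hV.1) ⟨x, hx, hx'⟩
    have h1 := hU.pos_of_return hh hc hn hi hy hz.1 hk hl.1 hk0
    have h2 := hV.pos_of_return hh hc hi hn' hz.2 hy' hl.2 hk' h1.le
    omega
  have hcov : ∀ x, x ∉ P → x ∈ N := by
    intro x hx
    obtain ⟨δ, hδ, ht⟩ := hsmall x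
    obtain ⟨z, hz, i, hi, l, hl⟩ := hret _ ht.1 ⟨x, mem_ball_self hδ⟩
    rcases le_total 0 l with h0 | h0
    · exact absurd ⟨_, ht, mem_ball_self hδ, z, hz, i, hi, l, hl, h0⟩ hx
    · exact ⟨_, ht, mem_ball_self hδ, z, hz, i, hi, l, hl, h0⟩
  have hPc : Pᶜ = N := Subset.antisymm (fun x hx => hcov x hx) fun x hx hx' => hdisj x hx' hx
  have hclopen : IsClopen P := ⟨⟨hPc ▸ hNo⟩, hPo⟩
  have hyP : y ∈ P := ⟨U, hU, hy, y, hy, n, hn, k, hk, hk0⟩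
  by_contra hneg
  have hyN : y' ∈ N := ⟨U', hU', hy', y', hy', n', hn', k', hk', by omega⟩
  rcases isClopen_iff.1 hclopen with h1 | h1
  · rw [h1] at hyP
    exact hyP
  · exact hdisj y' (h1 ▸ mem_univ _) hyN

theorem exists_fract_near (a : ℕ → ℝ) :
    ∃ t : ℝ, ∀ ρ > 0, ∃ l l', l < l' ∧ |Int.fract (a l) - t| < ρ ∧ |Int.fract (a l') - t| < ρ := by
  obtain ⟨t, -, φ, hφ, hlim⟩ := (isCompact_Icc (a := (0 : ℝ)) (b := 1)).tendsto_subseq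
    (x := fun n => Int.fract (a n)) fun n => ⟨Int.fract_nonneg _, (Int.fract_lt_one _).le⟩
  refine ⟨t, fun ρ hρ => ?_⟩
  obtain ⟨N, hN⟩ := Metric.tendsto_atTop.1 hlim ρ hρ
  exact ⟨φ N, φ (N + 1), hφ (by omega), hN N le_rfl, hN (N + 1) (by omega)⟩

namespace IsPlaneLift

variable {f : SympDiff} {lift : ℝ → ℝ} {F : ℂ ≃ₜ ℂ} {L : ℂ → ℂ}

theorem iterate_ne (hF : IsPlaneLift f lift F L)
    (hpseudo : ∀ z ∈ Disk, z ≠ 0 → ∀ n : ℕ, 1 ≤ n → f.toFun^[n] z ≠ z) {m : ℕ} (hm : 1 ≤ m)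
    (w : ℂ) (j : ℤ) : F^[m] w ≠ w + j * (2 * π * Complex.I) := by
  intro h
  refine hpseudo _ (cover_mem w) (cover_ne_zero w) m hm ?_
  rw [← hF.cover_iterate]
  exact cover_eq_iff.2 ⟨j, h⟩

/-- Tiles in a neighbourhood of the boundary. -/
theorem exists_isTile_boundary (hF : IsPlaneLift f lift F L)
    {m : ℕ} {t : ℝ} (ht : ∀ j : ℤ, lift^[m] t ≠ t + j) :
    ∃ ε > 0, IsTile (2 * π * Complex.I) F^[m]
      (toLeft ⁻¹' {ζ | -ε < ζ.re ∧ |ζ.im - 2 * π * t| < ε}) := by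
  have hLm : Continuous L^[m] := hF.continuous.iterate m
  have h1 : ∀ᶠ q : ℂ × ℝ in 𝓝 ((2 * π * Complex.I * t : ℂ), 2 * π * t),
      Complex.exp (((L^[m] q.1).im - q.2 : ℝ) * Complex.I) ≠ 1 := by
    have : Continuous fun q : ℂ × ℝ => Complex.exp (((L^[m] q.1).im - q.2 : ℝ) * Complex.I) := by
      fun_prop
    refine this.continuousAt.eventually_ne ?_
    simp only
    rw [hF.boundary_iterate, Ne, Complex.exp_eq_one_iff]
    rintro ⟨j, hj⟩
    refine ht j ?_
    have := congrArg Complex.im hj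
    simp at this
    have h2 : (2 * π) * (lift^[m] t - t - j) = 0 := by linarith
    rcases mul_eq_zero.1 h2 with h2 | h2
    · exact absurd h2 Real.two_pi_pos.ne'
    · linarith
  obtain ⟨δ, hδ, hb⟩ := Metric.eventually_nhds_iff_ball.1 h1
  set ε := min (δ / 2) 1 with hε
  have hε0 : 0 < ε := by positivity
  have hεδ : ε ≤ δ / 2 := min_le_left _ _
  have hε1 : ε ≤ 1 := min_le_right _ _
  refine ⟨ε, hε0, ?_, ?_, ?_, ?_⟩
  · refine IsOpen.preimage continuous_toLeft ?_
    exact (isOpen_lt continuous_const Complex.continuous_re).inter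
      (isOpen_lt (f := fun ζ : ℂ => |ζ.im - 2 * π * t|) (by fun_prop) continuous_const)
  · have : toLeft ⁻¹' {ζ | -ε < ζ.re ∧ |ζ.im - 2 * π * t| < ε} =
        Complex.re ⁻¹' Ioi (-Real.log ε) ∩ Complex.im ⁻¹' ball (2 * π * t) ε := by
      ext w
      simp only [mem_preimage, mem_ofPred_eq, toLeft, mem_inter_iff, mem_Ioi, mem_ball,
        Real.dist_eq, neg_lt_neg_iff]
      rw [← Real.lt_log_iff_exp_lt hε0, neg_lt]
    rw [this]
    exact (((convex_Ioi _).is_linear_preimage Complex.reLm.isLinear).inter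
      ((convex_ball _ _).is_linear_preimage Complex.imLm.isLinear)).isPreconnected
  · rintro z ⟨-, hz⟩ j ⟨-, hj⟩
    by_contra hj0
    have h5 : (1 : ℝ) ≤ |(j : ℝ)| := by exact_mod_cast Int.one_le_abs hj0
    have h6 : |(2 * π * j : ℝ)| < 2 := by
      have e : (toLeft (z - j * (2 * π * Complex.I))).im = (toLeft z).im - 2 * π * j := by
        simp [toLeft]
        ring
      rw [e] at hj
      rw [abs_lt] at hz hj ⊢
      constructor <;> linarith
    rw [abs_mul, abs_of_pos Real.two_pi_pos] at h6
    nlinarith [Real.pi_gt_three]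
  · rintro z ⟨hz1, hz2⟩ j ⟨-, hj⟩
    refine hb (toLeft z, (toLeft (F^[m] z - j * (2 * π * Complex.I))).im) ?_ ?_
    · rw [← ball_prod_same]
      refine ⟨?_, ?_⟩
      · rw [mem_ball, dist_eq_norm]
        refine (Complex.norm_le_abs_re_add_abs_im _).trans_lt ?_
        have h3 := re_toLeft_neg z
        have e1 : (toLeft z - 2 * π * Complex.I * t).re = (toLeft z).re := by simp
        have e2 : (toLeft z - 2 * π * Complex.I * t).im = (toLeft z).im - 2 * π * t := by simp
        rw [e1, e2, abs_of_neg h3]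
        linarith
      · rw [mem_ball, Real.dist_eq]
        linarith
    · rw [← hF.toLeft_iterate]
      have e : (toLeft (F^[m] z)).im - (toLeft (F^[m] z - j * (2 * π * Complex.I))).im
          = j * (2 * π) := by
        simp [toLeft]
      simp only [e]
      rw [← Complex.exp_int_mul_two_pi_mul_I j]
      push_cast
      ring_nf

theorem lift_iterate_add_int (hper : ∀ θ, lift (θ + 1) = lift θ + 1) (n : ℕ) (θ : ℝ) (j : ℤ) :
    lift^[n] (θ + j) = lift^[n] θ + j := by
  have h1 : ∀ θ, lift^[n] (θ + 1) = lift^[n] θ + 1 := by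
    induction n with
    | zero => simp
    | succ n ih =>
      intro z
      rw [Function.iterate_succ_apply', ih, hper, Function.iterate_succ_apply']
  induction j with
  | zero => simp
  | succ j ih =>
    push_cast at ih ⊢
    rw [← add_assoc, h1, ih, add_assoc]
  | pred j ih =>
    have := h1 (θ + (-j - 1))
    push_cast at ih ⊢
    rw [show θ + (-j - 1 : ℝ) + 1 = θ + -j by ring, ih] at this
    linarith

theorem exists_boundary_return (hF : IsPlaneLift f lift F L)
    (hper : ∀ θ, lift (θ + 1) = lift θ + 1) {m : ℕ} (hm : ∀ t, ∀ j : ℤ, lift^[m] t ≠ t + j)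
    (p : ℤ) :
    ∃ U, IsTile (2 * π * Complex.I) F^[m] U ∧ ∃ i j : ℕ, i < j ∧ ∃ y ∈ U,
      F^[m * (j - i)] y - (⌊lift^[m * j] 0 - j * p⌋ - ⌊lift^[m * i] 0 - i * p⌋ +
        (j - i : ℕ) * p : ℤ) * (2 * π * Complex.I) ∈ U := by
  set a : ℕ → ℝ := fun n => lift^[m * n] 0 - n * p with ha
  obtain ⟨t, ht⟩ := exists_fract_near a
  obtain ⟨ε, hε, hU⟩ := hF.exists_isTile_boundary (hm t)
  obtain ⟨i, j, hij, hi, hj⟩ := ht (ε / (2 * π)) (by positivity)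
  set V : Set ℂ := {ζ | -ε < ζ.re ∧ |ζ.im - 2 * π * t| < ε} with hV
  have hVo : IsOpen V := (isOpen_lt continuous_const Complex.continuous_re).inter
      (isOpen_lt (f := fun ζ : ℂ => |ζ.im - 2 * π * t|) (by fun_prop) continuous_const)
  have hVmem : ∀ s : ℝ, |s - t| < ε / (2 * π) → (2 * π * Complex.I * s : ℂ) ∈ V := by
    intro s hs
    rw [lt_div_iff₀ Real.two_pi_pos] at hs
    constructor
    · simpa using hε
    · have : (2 * π * Complex.I * s : ℂ).im - 2 * π * t = (s - t) * (2 * π) := by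
        simp
        ring
      rw [this, abs_mul, abs_of_pos Real.two_pi_pos]
      exact hs
  set k : ℤ := ⌊a j⌋ - ⌊a i⌋ + (j - i : ℕ) * p with hk
  have hlift : lift^[m * (j - i)] (Int.fract (a i)) = Int.fract (a j) + k := by
    have e1 : m * j = m * (j - i) + m * i := by
      rw [← mul_add, Nat.sub_add_cancel hij.le]
    have e2 : Int.fract (a i) = lift^[m * i] 0 + (-(i * p) - ⌊a i⌋ : ℤ) := by
      rw [Int.fract]
      simp only [ha]
      push_cast
      ring
    have e3 : Int.fract (a j) = lift^[m * j] 0 - j * p - ⌊a j⌋ := rfl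
    rw [e2, lift_iterate_add_int hper, ← Function.iterate_add_apply, ← e1, e3, hk]
    push_cast [Nat.cast_sub hij.le]
    ring
  refine ⟨_, hU, i, j, hij, ?_⟩
  set w : ℝ → ℂ := fun s => s + 2 * π * Int.fract (a i) * Complex.I with hw
  have hlim : Tendsto (fun s => toLeft (w s)) atTop
      (𝓝 (2 * π * Complex.I * (Int.fract (a i) : ℝ))) := by
    have e : ∀ s, toLeft (w s) = ((-Real.exp (-s) : ℝ) : ℂ) +
        2 * π * Complex.I * (Int.fract (a i) : ℝ) := by
      intro s
      apply Complex.ext <;> simp [toLeft, hw, -Complex.ofReal_exp]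
    simp only [e]
    have h1 : Tendsto (fun s : ℝ => ((-Real.exp (-s) : ℝ) : ℂ)) atTop (𝓝 ((-0 : ℝ) : ℂ)) :=
      (Complex.continuous_ofReal.tendsto _).comp (Real.tendsto_exp_neg_atTop_nhds_zero.neg)
    simpa using h1.add_const (2 * π * Complex.I * (Int.fract (a i) : ℝ) : ℂ)
  have hlim2 : Tendsto (fun s => L^[m * (j - i)] (toLeft (w s)) - k * (2 * π * Complex.I)) atTop
      (𝓝 (2 * π * Complex.I * (Int.fract (a j) : ℝ))) := by
    have h1 := (((hF.continuous.iterate (m * (j - i))).tendsto _).comp hlim).sub_const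
      (k * (2 * π * Complex.I) : ℂ)
    rw [hF.boundary_iterate, hlift] at h1
    have e : (2 * π * Complex.I * (Int.fract (a j) : ℝ) : ℂ) =
        2 * π * Complex.I * (Int.fract (a j) + k : ℝ) - k * (2 * π * Complex.I) := by
      push_cast
      ring
    rw [e]
    exact h1
  obtain ⟨s, hs1, hs2⟩ := ((hlim.eventually (hVo.mem_nhds (hVmem _ hi))).and
    (hlim2.eventually (hVo.mem_nhds (hVmem _ hj)))).exists
  refine ⟨w s, hs1, ?_⟩
  have e : toLeft (F^[m * (j - i)] (w s) - k * (2 * π * Complex.I)) =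
      L^[m * (j - i)] (toLeft (w s)) - k * (2 * π * Complex.I) := by
    rw [← hF.toLeft_iterate]
    have h2 : ∀ x (j : ℤ), toLeft (x + j * (2 * π * Complex.I)) =
        toLeft x + j * (2 * π * Complex.I) := fun x j => by
      simpa using iterate_add_mul toLeft_add 1 x j
    have := h2 (F^[m * (j - i)] (w s)) (-k)
    push_cast at this
    simpa [sub_eq_add_neg] using this
  rw [mem_preimage, e]
  exact hs2

/-- The winding numbers of the returns to a tile are controlled by the boundary rotation number. -/
theorem winding (hF : IsPlaneLift f lift F L)
    (hpseudo : ∀ z ∈ Disk, z ≠ 0 → ∀ n : ℕ, 1 ≤ n → f.toFun^[n] z ≠ z)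
    (hmono : StrictMono lift)
    (hper : ∀ θ : ℝ, lift (θ + 1) = lift θ + 1)
    (hproj : ∀ θ : ℝ,
      f.toFun (Complex.exp (2 * π * Complex.I * θ)) = Complex.exp (2 * π * Complex.I * lift θ))
    {α : ℝ} (hα : ∀ θ : ℝ, Tendsto (fun n : ℕ => (lift^[n] θ - θ) / n) atTop (𝓝 α))
    {m : ℕ} (hm : 1 ≤ m) {U : Set ℂ} (hU : IsTile (2 * π * Complex.I) F^[m] U) {y : ℂ}
    {n : ℕ} {k : ℤ} (hn : 1 ≤ n) (hy : y ∈ U) (hk : F^[m * n] y - k * (2 * π * Complex.I) ∈ U)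
    (p : ℤ) : ((p : ℝ) < m * α → n * p < k) ∧ (m * α < p → k < n * p) := by
  obtain ⟨h, hh, hc, hit⟩ := hF.exists_brouwer hpseudo hm p
  have h1 : ∀ w, h w = F^[m] w - p * (2 * π * Complex.I) := by
    intro w
    have := hit 1 w
    simpa using this
  have htile : ∀ {U}, IsTile (2 * π * Complex.I) F^[m] U → IsTile (2 * π * Complex.I) h U := by
    intro U hU
    refine ⟨hU.1, hU.2, hU.3, fun z hz j hj => hU.4 z hz (j + p) ?_⟩
    rw [h1] at hj
    convert hj using 1
    push_cast
    ring
  have hsmall : ∀ x, ∃ δ > 0, IsTile (2 * π * Complex.I) h (ball x δ) := fun x => by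
    refine exists_isTile_ball h.continuous fun j hj => hF.iterate_ne hpseudo hm x (j + p) ?_
    rw [h1] at hj
    push_cast
    linear_combination hj
  have hret : ∀ U : Set ℂ, IsOpen U → U.Nonempty →
      ∃ y ∈ U, ∃ n ≥ 1, ∃ k : ℤ, h^[n] y - k * (2 * π * Complex.I) ∈ U := by
    intro U hU hne
    obtain ⟨y, hy, n, hn, k, hk⟩ := hF.exists_return m hU hne
    refine ⟨y, hy, n, hn, k - n * p, ?_⟩
    rw [hit]
    convert hk using 1
    push_cast
    ring
  have hk' : h^[n] y - (k - n * p : ℤ) * (2 * π * Complex.I) ∈ U := by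
    rw [hit]
    convert hk using 1
    push_cast
    ring
  have hcirc : ∀ t, ∀ j : ℤ, lift^[m] t ≠ t + j := by
    intro t j hj
    have h2 : ∀ i, f.toFun^[i] (Complex.exp (2 * π * Complex.I * t)) =
        Complex.exp (2 * π * Complex.I * (lift^[i] t : ℝ)) := by
      intro i
      induction i with
      | zero => rfl
      | succ i ih => rw [Function.iterate_succ_apply', ih, hproj, Function.iterate_succ_apply']
    refine hpseudo _ (SympDiff.mem_disk_of_norm_eq_one (norm_exp_two_pi t))
      (Complex.exp_ne_zero _) m hm ?_
    rw [h2, hj, Complex.exp_eq_exp_iff_exists_int]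
    refine ⟨j, ?_⟩
    push_cast
    ring
  obtain ⟨V, hV, i, j, hij, x, hx, hx'⟩ := hF.exists_boundary_return hper hcirc p
  have hx'' : h^[j - i] x - (⌊lift^[m * j] 0 - j * p⌋ - ⌊lift^[m * i] 0 - i * p⌋ : ℤ) *
      (2 * π * Complex.I) ∈ V := by
    rw [hit]
    convert hx' using 1
    push_cast
    ring
  set γ : ℝ → ℝ := fun θ => lift^[m] θ - p with hγ
  have hγm : Monotone γ := fun a b hab => sub_le_sub_right ((hmono.monotone.iterate m) hab) _
  have hγi : ∀ n, γ^[n] 0 = lift^[m * n] 0 - n * p := by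
    intro n
    induction n with
    | zero => simp
    | succ n ih =>
      rw [Function.iterate_succ_apply', ih]
      simp only [hγ]
      have := lift_iterate_add_int hper m (lift^[m * n] 0) (-(n * p))
      push_cast at this ⊢
      rw [sub_eq_add_neg (lift^[m * n] 0), this, ← Function.iterate_add_apply, mul_add_one, add_comm m]
      ring
  have hlim : Tendsto (fun n : ℕ => γ^[n] 0 / n) atTop (𝓝 (m * α - p)) := by
    have h2 : Tendsto (fun n : ℕ => m * n) atTop atTop :=
      tendsto_id.const_mul_atTop' (by omega)
    have h3 := (((hα 0).comp h2).const_mul (m : ℝ)).sub_const (p : ℝ)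
    refine h3.congr' ?_
    filter_upwards [eventually_ge_atTop 1] with n hn
    have hn' : (n : ℝ) ≠ 0 := by positivity
    have hm' : (m : ℝ) ≠ 0 := by positivity
    simp only [Function.comp_apply, hγi]
    push_cast
    field_simp
    ring
  constructor
  · intro hp
    have h0 : 0 ≤ γ 0 := by
      by_contra hneg
      have h2 := hγm.antitone_iterate_of_map_le (not_le.1 hneg).le
      have h3 : (m * α - p : ℝ) ≤ 0 := le_of_tendsto' hlim fun n =>
        div_nonpos_of_nonpos_of_nonneg (h2 (zero_le : 0 ≤ n)) n.cast_nonneg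
      linarith
    have h2 := hγm.monotone_iterate_of_le_map h0 hij.le
    simp only [hγi] at h2
    have := hh.pos_of_return hc hsmall hret (htile hV) (htile hU) (by omega) hn hx hy hx'' hk'
      (sub_nonneg.2 (Int.floor_le_floor h2))
    omega
  · intro hp
    have h0 : γ 0 ≤ 0 := by
      by_contra hneg
      have h2 := hγm.monotone_iterate_of_le_map (not_le.1 hneg).le
      have h3 : (0 : ℝ) ≤ m * α - p := ge_of_tendsto' hlim fun n =>
        div_nonneg (h2 (zero_le : 0 ≤ n)) n.cast_nonneg
      linarith
    have h2 := hγm.antitone_iterate_of_map_le h0 hij.le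
    simp only [hγi] at h2
    by_contra hneg
    have := hh.pos_of_return hc hsmall hret (htile hU) (htile hV) hn (by omega) hy hx hk' hx''
      (by omega)
    have := Int.floor_le_floor h2
    omega

end IsPlaneLift

/-! ### A maximal inequality -/

section Maximal

variable {X : Type*}

/-- The maximum of `0` and of the first Birkhoff sums. -/
def birkhoffMax (T : X → X) (φ : X → ℝ) : ℕ → X → ℝ
  | 0 => fun _ => 0
  | n + 1 => fun x => max 0 (φ x + birkhoffMax T φ n (T x))

theorem birkhoffMax_nonneg (T : X → X) (φ : X → ℝ) (n : ℕ) (x : X) : 0 ≤ birkhoffMax T φ n x := by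
  cases n
  · exact le_rfl
  · exact le_max_left _ _

theorem birkhoffMax_le_succ (T : X → X) (φ : X → ℝ) (n : ℕ) :
    ∀ x, birkhoffMax T φ n x ≤ birkhoffMax T φ (n + 1) x := by
  induction n with
  | zero => exact fun x => birkhoffMax_nonneg T φ 1 x
  | succ n ih => exact fun x => max_le_max le_rfl (add_le_add le_rfl (ih _))

theorem birkhoffSum_le_birkhoffMax (T : X → X) (φ : X → ℝ) (n : ℕ) :
    ∀ x, birkhoffSum T φ n x ≤ birkhoffMax T φ n x := by
  induction n with
  | zero => exact fun x => by simp [birkhoffMax]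
  | succ n ih =>
    intro x
    rw [birkhoffSum_succ']
    exact (add_le_add le_rfl (ih _)).trans (le_max_right _ _)

variable [MeasurableSpace X] {μ : Measure X} {T : X → X}

theorem measurable_birkhoffMax (hT : Measurable T) {φ : X → ℝ} (hφ : Measurable φ) (n : ℕ) :
    Measurable (birkhoffMax T φ n) := by
  induction n with
  | zero => exact measurable_const
  | succ n ih => exact measurable_const.max (hφ.add (ih.comp hT))

theorem integrable_birkhoffMax (hT : MeasurePreserving T μ μ) {φ : X → ℝ} (hφ : Integrable φ μ)
    (n : ℕ) : Integrable (birkhoffMax T φ n) μ := by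
  induction n with
  | zero => exact integrable_zero _ _ _
  | succ n ih => exact (integrable_zero _ _ _).sup (hφ.add (hT.integrable_comp_of_integrable ih))

theorem integral_nonneg_of_birkhoffSum_pos [IsFiniteMeasure μ]
    (hT : MeasurePreserving T μ μ) {φ : X → ℝ}
    (hφm : Measurable φ) (hφ : Integrable φ μ) (h : ∀ᵐ x ∂μ, ∃ n, 0 < birkhoffSum T φ n x) :
    0 ≤ ∫ x, φ x ∂μ := by
  set E : ℕ → Set X := fun n => {x | 0 < birkhoffMax T φ n x} with hE
  have hEm : ∀ n, MeasurableSet (E n) := fun n =>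
    measurableSet_lt measurable_const (measurable_birkhoffMax hT.measurable hφm n)
  have hmono : Monotone E := monotone_nat_of_le_succ fun n x hx =>
    lt_of_lt_of_le hx (birkhoffMax_le_succ T φ n x)
  have h1 : ∀ n, 0 ≤ ∫ x in E (n + 1), φ x ∂μ := by
    intro n
    have hi := hT.integrable_comp_of_integrable (integrable_birkhoffMax hT hφ n)
    calc (0 : ℝ) ≤ ∫ x, birkhoffMax T φ (n + 1) x ∂μ - ∫ x, birkhoffMax T φ n x ∂μ :=
          sub_nonneg.2 (integral_mono (integrable_birkhoffMax hT hφ _)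
            (integrable_birkhoffMax hT hφ _) (birkhoffMax_le_succ T φ n))
      _ = ∫ x, birkhoffMax T φ (n + 1) x ∂μ - ∫ x, birkhoffMax T φ n (T x) ∂μ := by
          congr 1
          have := integral_map (μ := μ) hT.measurable.aemeasurable (f := birkhoffMax T φ n)
            (measurable_birkhoffMax hT.measurable hφm n).aestronglyMeasurable
          rw [← this, hT.map_eq]
      _ = ∫ x, (birkhoffMax T φ (n + 1) x - birkhoffMax T φ n (T x)) ∂μ :=
          (integral_sub (integrable_birkhoffMax hT hφ _) hi).symm
      _ ≤ ∫ x, (E (n + 1)).indicator φ x ∂μ := by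
          refine integral_mono ((integrable_birkhoffMax hT hφ _).sub hi)
            (hφ.indicator (hEm _)) fun x => ?_
          by_cases hx : x ∈ E (n + 1)
          · rw [indicator_of_mem hx]
            have h2 : (0 : ℝ) < max 0 (φ x + birkhoffMax T φ n (T x)) := hx
            have h3 : birkhoffMax T φ (n + 1) x = φ x + birkhoffMax T φ n (T x) :=
              max_eq_right (by
                by_contra hneg
                rw [max_eq_left (not_le.1 hneg).le] at h2
                exact lt_irrefl _ h2)
            simp only [h3, add_sub_cancel_right, le_refl]
          · rw [indicator_of_notMem hx]
            have h2 : birkhoffMax T φ (n + 1) x ≤ 0 := not_lt.1 hx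
            have h3 := birkhoffMax_nonneg T φ n (T x)
            simp only
            linarith
      _ = ∫ x in E (n + 1), φ x ∂μ := integral_indicator (hEm _)
  have h2 := tendsto_setIntegral_of_monotone hEm hmono hφ.integrableOn
  have h3 : ∫ x in ⋃ n, E n, φ x ∂μ = ∫ x, φ x ∂μ := by
    refine setIntegral_eq_integral_of_ae_compl_eq_zero ?_
    filter_upwards [h] with x ⟨n, hn⟩ hx
    exact absurd (mem_iUnion.2 ⟨n, hn.trans_le (birkhoffSum_le_birkhoffMax T φ n x)⟩) hx
  rw [h3] at h2
  exact ge_of_tendsto ((tendsto_add_atTop_iff_nat 1).2 h2) (Eventually.of_forall h1)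

/-- If almost every point has a nonpositive Birkhoff sum, the integral is nonpositive. -/
theorem integral_nonpos_of_birkhoffSum_nonpos [IsFiniteMeasure μ]
    (hT : MeasurePreserving T μ μ) {φ : X → ℝ}
    (hφm : Measurable φ) (hφ : Integrable φ μ)
    (h : ∀ᵐ x ∂μ, ∃ n, 1 ≤ n ∧ birkhoffSum T φ n x ≤ 0) : ∫ x, φ x ∂μ ≤ 0 := by
  have h1 : ∀ ε > 0, ∫ x, φ x ∂μ ≤ ε * μ.real univ := by
    intro ε hε
    have h2 := integral_nonneg_of_birkhoffSum_pos hT (φ := fun x => ε - φ x)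
      (measurable_const.sub hφm) ((integrable_const ε).sub hφ) (by
        filter_upwards [h] with x ⟨n, hn, hx⟩
        refine ⟨n, ?_⟩
        have h3 : birkhoffSum T (fun x => ε - φ x) n x = n * ε - birkhoffSum T φ n x := by
          simp [birkhoffSum]
        rw [h3]
        have : (0 : ℝ) < n := by exact_mod_cast hn
        nlinarith [mul_pos this hε])
    rw [integral_sub (integrable_const ε) hφ, integral_const, smul_eq_mul] at h2
    linarith
  have h2 : Tendsto (fun ε : ℝ => ε * μ.real univ) (𝓝[>] 0) (𝓝 (0 * μ.real univ)) :=
    (tendsto_id.mul_const _).mono_left nhdsWithin_le_nhds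
  rw [zero_mul] at h2
  exact ge_of_tendsto h2 (by filter_upwards [self_mem_nhdsWithin] with ε hε using h1 ε hε)

end Maximal

/-! ### Free disks have small area -/

theorem exists_lifted_ball {z₀ : ℂ} {r : ℝ} (hr : r < ‖z₀‖) (hB : ball z₀ r ⊆ ball 0 1) :
    ∃ U : Set ℂ, IsOpen U ∧ IsPreconnected U ∧ cover '' U = ball z₀ r ∧
      ∀ w ∈ U, ∀ j : ℤ, w - j * (2 * π * Complex.I) ∈ U → j = 0 := by
  have hz : ∀ z ∈ ball z₀ r, 0 < (z / z₀).re ∧ z ≠ 0 ∧ z₀ ≠ 0 := by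
    intro z hz
    have hr0 : 0 < r := dist_nonneg.trans_lt hz
    have h0 : z₀ ≠ 0 := norm_pos_iff.1 (hr0.trans hr)
    refine ⟨?_, ?_, h0⟩
    · have h1 : ‖z / z₀ - 1‖ < 1 := by
        rw [div_sub_one h0, norm_div, div_lt_one (norm_pos_iff.2 h0)]
        exact (mem_ball_iff_norm.1 hz).trans hr
      have h2 := (Complex.abs_re_le_norm _).trans_lt h1
      rw [Complex.sub_re, Complex.one_re, abs_lt] at h2
      linarith
    · rintro rfl
      rw [mem_ball_iff_norm, zero_sub, norm_neg] at hz
      linarith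
  set s : ℂ → ℂ := fun z => Complex.log (z / z₀) + Complex.log z₀ with hs
  have hexp : ∀ z ∈ ball z₀ r, Complex.exp (s z) = z := by
    intro z hzB
    obtain ⟨h1, h2, h3⟩ := hz z hzB
    simp only [hs]
    rw [Complex.exp_add, Complex.exp_log (div_ne_zero h2 h3), Complex.exp_log h3,
      div_mul_cancel₀ _ h3]
  have hneg : ∀ z ∈ ball z₀ r, (s z).re < 0 := by
    intro z hzB
    rw [← Real.exp_lt_one_iff, ← Complex.norm_exp, hexp z hzB]
    exact mem_ball_zero_iff.1 (hB hzB)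
  have hcov : ∀ z ∈ ball z₀ r, cover (ofLeft (s z)) = z := by
    intro z hzB
    rw [cover, toLeft_ofLeft (hneg z hzB), hexp z hzB]
  have hsc : ContinuousOn (fun z => ofLeft (s z)) (ball z₀ r) := by
    intro z hzB
    obtain ⟨h1, h2, h3⟩ := hz z hzB
    refine ContinuousAt.continuousWithinAt ?_
    refine ContinuousAt.comp (continuousAt_ofLeft (hneg z hzB)) ?_
    exact ((continuousAt_id.div_const z₀).clog (Or.inl h1)).add continuousAt_const
  have himg : (fun z => ofLeft (s z)) '' ball z₀ r =
      cover ⁻¹' ball z₀ r ∩ {w | |(toLeft w).im - (Complex.log z₀).im| < π / 2} := by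
    ext w
    constructor
    · rintro ⟨z, hzB, rfl⟩
      refine ⟨?_, ?_⟩
      · rw [mem_preimage, hcov z hzB]
        exact hzB
      · simp only [mem_ofPred_eq]
        rw [toLeft_ofLeft (hneg z hzB)]
        simp only [hs, Complex.add_im, add_sub_cancel_right, Complex.log_im]
        exact Complex.abs_arg_lt_pi_div_two_iff.2 (Or.inl (hz z hzB).1)
    · rintro ⟨hwB, hw⟩
      refine ⟨cover w, hwB, ?_⟩
      have h0 := (hz _ hwB).2.2
      rw [mem_ofPred_eq, abs_lt] at hw
      have e : s (cover w) = toLeft w := by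
        have h1 : cover w / z₀ = Complex.exp (toLeft w - Complex.log z₀) := by
          rw [Complex.exp_sub, Complex.exp_log h0, cover]
        simp only [hs]
        rw [h1, Complex.log_exp, sub_add_cancel] <;> rw [Complex.sub_im] <;>
          linarith [Real.pi_pos]
      simp only [e, ofLeft_toLeft]
  refine ⟨(fun z => ofLeft (s z)) '' ball z₀ r, ?_, ?_, ?_, ?_⟩
  · rw [himg]
    exact (isOpen_ball.preimage continuous_cover).inter
      (isOpen_lt ((Complex.continuous_im.comp continuous_toLeft).sub continuous_const).abs
        continuous_const)
  · exact (convex_ball _ _).isPreconnected.image _ hsc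
  · ext z
    constructor
    · rintro ⟨_, ⟨z', hz', rfl⟩, rfl⟩
      rw [hcov z' hz']
      exact hz'
    · intro hz'
      exact ⟨_, ⟨z, hz', rfl⟩, hcov z hz'⟩
  · rintro _ ⟨z, hzB, rfl⟩ j ⟨z', hzB', e⟩
    have h1 : z' = z := by
      rw [← hcov z hzB, ← hcov z' hzB', cover_eq_iff]
      refine ⟨-j, ?_⟩
      simp only at e
      rw [e]
      push_cast
      ring
    subst h1
    have h2 : (j : ℂ) * (2 * π * Complex.I) = 0 := by linear_combination e
    rcases mul_eq_zero.1 h2 with h2 | h2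
    · exact_mod_cast h2
    · exact absurd h2 Complex.two_pi_I_ne_zero

/-- The winding numbers of the returns to tiles are controlled by `α`. -/
def RotatesBy (F : ℂ → ℂ) (α : ℝ) : Prop :=
  ∀ m : ℕ, 1 ≤ m → ∀ U, IsTile (2 * π * Complex.I) F^[m] U → ∀ (y : ℂ) (n : ℕ) (k : ℤ),
    1 ≤ n → y ∈ U → F^[m * n] y - k * (2 * π * Complex.I) ∈ U →
    ∀ p : ℤ, ((p : ℝ) < m * α → n * p < k) ∧ (m * α < p → k < n * p)

theorem RotatesBy.pos {F : ℂ → ℂ} {α : ℝ} (h : RotatesBy F α) {m : ℕ} (hm : 1 ≤ m) {U : Set ℂ}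
    (hU : IsTile (2 * π * Complex.I) F^[m] U) {y : ℂ} {n : ℕ} {k : ℤ} (hn : 1 ≤ n) (hy : y ∈ U)
    (hk : F^[m * n] y - k * (2 * π * Complex.I) ∈ U) {σ : ℤ} (hσ : σ = 1 ∨ σ = -1) {p : ℤ}
    (hp : 0 < σ * (m * α - p)) : 0 < σ * (k - n * p) := by
  have := h m hm U hU y n k hn hy hk p
  rcases hσ with rfl | rfl
  · have := this.1 (by push_cast at hp; linarith)
    omega
  · have := this.2 (by push_cast at hp; linarith)
    omega

namespace IsPlaneLift

variable {f : SympDiff} {lift : ℝ → ℝ} {F : ℂ ≃ₜ ℂ} {L : ℂ → ℂ}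

theorem mul_sq_le_one_of_free (hF : IsPlaneLift f lift F L)
    (hpseudo : ∀ z ∈ Disk, z ≠ 0 → ∀ n : ℕ, 1 ≤ n → f.toFun^[n] z ≠ z)
    {α : ℝ} (hrot : RotatesBy F α) {q N : ℕ} (hq : 1 ≤ q) (hN : 1 ≤ N) {p : ℤ}
    (hp0 : q * α - p ≠ 0) (hpN : N * |q * α - p| < 1) {z₀ : ℂ} {r : ℝ} (hr0 : 0 ≤ r)
    (hr : r < ‖z₀‖)
    (hB : ball z₀ r ⊆ ball 0 1) (hfree : ∀ z ∈ ball z₀ r, f.toFun^[q] z ∉ ball z₀ r) :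
    N * r ^ 2 ≤ 1 := by
  classical
  obtain ⟨U, hUo, hUc, himg, hU0⟩ := exists_lifted_ball hr hB
  have hmem : ∀ w ∈ U, cover w ∈ ball z₀ r := fun w hw => himg ▸ mem_image_of_mem _ hw
  have hlift : ∀ w, cover w ∈ ball z₀ r → ∃ c : ℤ, w - c * (2 * π * Complex.I) ∈ U := by
    intro w hw
    rw [← himg] at hw
    obtain ⟨u, hu, e⟩ := hw
    obtain ⟨j, hj⟩ := cover_eq_iff.1 e
    refine ⟨-j, ?_⟩
    convert hu using 1
    rw [hj]
    push_cast
    ring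
  have hcs : ∀ w (j : ℤ), cover (w - j * (2 * π * Complex.I)) = cover w := by
    intro w j
    refine cover_eq_iff.2 ⟨-j, ?_⟩
    push_cast
    ring
  have hadd : ∀ n w (j : ℤ), F^[n] (w - j * (2 * π * Complex.I)) =
      F^[n] w - j * (2 * π * Complex.I) := by
    intro n w j
    have := iterate_add_mul hF.add n w (-j)
    push_cast at this
    simpa [sub_eq_add_neg] using this
  have hU : IsTile (2 * π * Complex.I) F^[q] U := by
    refine ⟨hUo, hUc, hU0, fun z hz j hj => hfree _ (hmem z hz) ?_⟩
    rw [← hF.cover_iterate, ← hcs _ j]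
    exact hmem _ hj
  obtain ⟨σ, hσ, hσp⟩ : ∃ σ : ℤ, (σ = 1 ∨ σ = -1) ∧ (σ : ℝ) * (q * α - p) = |q * α - p| := by
    rcases le_total 0 (q * α - p) with h | h
    · exact ⟨1, Or.inl rfl, by rw [abs_of_nonneg h]; simp⟩
    · exact ⟨-1, Or.inr rfl, by rw [abs_of_nonpos h]; simp⟩
  have hσσ : (σ : ℝ) * σ = 1 := by rcases hσ with rfl | rfl <;> norm_num
  have hσσ' : σ * σ = 1 := by rcases hσ with rfl | rfl <;> norm_num
  have habs : 0 < |q * α - p| := abs_pos.2 hp0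
  set μ : Measure ℂ := volume.restrict Disk with hμ
  have hT : MeasurePreserving f.ext^[q] μ μ := f.measurePreserving_ext.iterate q
  have hiter : ∀ z ∈ Disk, ∀ i, (f.ext^[q])^[i] z = f.toFun^[q * i] z := by
    intro z hz i
    rw [← Function.iterate_mul, f.ext_iterate hz]
  set φ : ℂ → ℝ := fun z => (ball z₀ r).indicator 1 z - (N : ℝ)⁻¹ with hφ
  have hBm : MeasurableSet (ball z₀ r) := isOpen_ball.measurableSet
  have hi1 : Integrable ((ball z₀ r).indicator (1 : ℂ → ℝ)) μ :=
    (integrable_const (1 : ℝ)).indicator hBm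
  have hN0 : (0 : ℝ) < N := by exact_mod_cast hN
  have hinner := integral_nonpos_of_birkhoffSum_nonpos hT (φ := φ)
    ((measurable_one.indicator hBm).sub measurable_const) (hi1.sub (integrable_const _)) (by
      have hrec := (hT.iterate N).conservative.ae_frequently_mem_of_mem_nhds
      filter_upwards [hrec, ae_restrict_mem isClosed_closedBall.measurableSet] with y hy hyD
      by_cases hyB : y ∈ ball z₀ r
      swap
      · refine ⟨1, le_rfl, ?_⟩
        rw [birkhoffSum_one]
        simp only [hφ, indicator_of_notMem hyB, zero_sub]
        exact neg_nonpos.2 (by positivity)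
      obtain ⟨w, hwU, rfl⟩ : y ∈ cover '' U := himg ▸ hyB
      obtain ⟨δ, hδ, ht⟩ := exists_isTile_ball (F.continuous.iterate (q * N))
        (hF.iterate_ne hpseudo (Nat.mul_pos hq hN) w)
      obtain ⟨n, hn, u, ⟨huδ, huU⟩, hu⟩ := Filter.frequently_atTop.1 (hy _
        ((isOpenMap_cover _ (isOpen_ball.inter hUo)).mem_nhds
          (mem_image_of_mem _ ⟨mem_ball_self hδ, hwU⟩))) 1
      rw [← Function.iterate_mul, hiter _ hyD, ← hF.cover_iterate] at hu
      obtain ⟨k, hk⟩ : ∃ k : ℤ, F^[q * (N * n)] w - k * (2 * π * Complex.I) = u := by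
        obtain ⟨j, hj⟩ := cover_eq_iff.1 hu
        exact ⟨-j, by rw [hj]; push_cast; ring⟩
      rw [← hk] at huδ huU
      have hK : σ * (k - n * (N * p)) < n := by
        have h1 := hrot.pos (Nat.mul_pos hq hN) ht (n := n) (k := k) hn (mem_ball_self hδ)
          (by rw [mul_assoc]; exact huδ) (σ := -σ) (p := N * p + σ) (by omega) (by
            push_cast
            nlinarith)
        nlinarith
      have hw : ∀ i j : ℕ, i < j → ∀ a b : ℤ, F^[q * i] w - a * (2 * π * Complex.I) ∈ U →
          F^[q * j] w - b * (2 * π * Complex.I) ∈ U → σ * (a - i * p) < σ * (b - j * p) := by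
        intro i j hij a b ha hb
        have h1 := hrot.pos hq hU (n := j - i) (k := b - a) (by omega) ha (by
          rw [hadd, ← Function.iterate_add_apply, ← mul_add, Nat.sub_add_cancel hij.le]
          convert hb using 1
          push_cast
          ring) hσ (p := p) (by rw [hσp]; exact habs)
        push_cast [Nat.cast_sub hij.le] at h1
        linarith
      refine ⟨N * n, Nat.mul_pos hN hn, ?_⟩
      have hc : ∀ i : ℕ, ∃ c : ℤ, f.toFun^[q * i] (cover w) ∈ ball z₀ r →
          F^[q * i] w - c * (2 * π * Complex.I) ∈ U := by
        intro i
        by_cases h : f.toFun^[q * i] (cover w) ∈ ball z₀ r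
        · rw [← hF.cover_iterate] at h
          obtain ⟨c, hc⟩ := hlift _ h
          exact ⟨c, fun _ => hc⟩
        · exact ⟨0, fun h' => absurd h' h⟩
      choose c hc using hc
      set V : Finset ℕ :=
        (Finset.range (N * n)).filter fun i => f.toFun^[q * i] (cover w) ∈ ball z₀ r with hV
      have hcard : V.card ≤ n := by
        have h1 := Finset.card_le_card_of_injOn (s := V) (t := Finset.Ico (0 : ℤ) n)
          (fun i => σ * (c i - i * p)) (by
            intro i hi
            rw [Finset.mem_coe, hV, Finset.mem_filter, Finset.mem_range] at hi
            obtain ⟨hi1, hi2⟩ := hi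
            have hci := hc i hi2
            have h2 := hw i (N * n) hi1 _ _ hci huU
            rw [Finset.mem_coe, Finset.mem_Ico]
            constructor
            · rcases Nat.eq_zero_or_pos i with rfl | hi0
              · have := hU0 w hwU (c 0) (by simpa using hci)
                simp [this]
              · have := hw 0 i hi0 0 _ (by simpa using hwU) hci
                simpa using this.le
            · refine lt_trans h2 (lt_of_eq_of_lt ?_ hK)
              push_cast
              ring)
          (by
            intro i hi j hj hij
            rw [Finset.mem_coe, hV, Finset.mem_filter, Finset.mem_range] at hi hj
            simp only at hij
            rcases lt_trichotomy i j with h | h | h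
            · exact absurd hij (hw i j h _ _ (hc i hi.2) (hc j hj.2)).ne
            · exact h
            · exact absurd hij (hw j i h _ _ (hc j hj.2) (hc i hi.2)).ne')
        simpa using h1
      have hsum : birkhoffSum f.ext^[q] φ (N * n) (cover w) = V.card - n := by
        simp only [birkhoffSum, hφ, Finset.sum_sub_distrib, Finset.sum_const, Finset.card_range]
        congr 1
        · rw [hV, Finset.card_filter]
          push_cast
          refine Finset.sum_congr rfl fun i _ => ?_
          rw [hiter _ hyD, indicator_apply]
          rfl
        · rw [nsmul_eq_mul]
          push_cast
          field_simp
      rw [hsum, sub_nonpos]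
      exact_mod_cast hcard)
  simp only [hφ] at hinner
  rw [integral_sub hi1 (integrable_const _), integral_indicator_one hBm, integral_const,
    smul_eq_mul, measureReal_restrict_apply hBm, measureReal_restrict_apply_univ,
    inter_eq_left.2 (show ball z₀ r ⊆ Disk from hB.trans ball_subset_closedBall), Disk, Measure.real, Measure.real,
    Complex.volume_ball, Complex.volume_closedBall] at hinner
  simp only [ENNReal.toReal_mul, ENNReal.toReal_pow, ENNReal.toReal_ofReal hr0,
    ENNReal.ofReal_one, one_pow, one_mul, ENNReal.coe_toReal, NNReal.coe_real_pi] at hinner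
  have h1 : (r ^ 2 - (N : ℝ)⁻¹) * π ≤ 0 := by linarith
  have h2 : r ^ 2 ≤ (N : ℝ)⁻¹ := by
    by_contra hneg
    have := mul_pos (sub_pos.2 (not_le.1 hneg)) Real.pi_pos
    linarith
  calc N * r ^ 2 ≤ N * (N : ℝ)⁻¹ := by gcongr
    _ = 1 := mul_inv_cancel₀ hN0.ne'

end IsPlaneLift

/-! ### Displacement and action of the iterates -/

theorem displacement_le {g : ℂ → ℂ} {K r : ℝ} (hK : 1 ≤ K) (hr : 0 < r) (hr4 : r ≤ 1 / 4)
    (hg : ∀ z ∈ Disk, ∀ w ∈ Disk, ‖g z - g w‖ ≤ K * ‖z - w‖)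
    (hfree : ∀ z₀, r < ‖z₀‖ → ball z₀ r ⊆ ball 0 1 → ∃ z ∈ ball z₀ r, g z ∈ ball z₀ r) :
    ∀ z ∈ Disk, ‖g z - z‖ ≤ 10 * K * r := by
  have h1 : ∀ z₀, r < ‖z₀‖ → ‖z₀‖ ≤ 1 - r → ‖g z₀ - z₀‖ ≤ (K + 1) * r := by
    intro z₀ h0 h0'
    have hsub : ball z₀ r ⊆ ball 0 1 := ball_subset_ball' (by rw [dist_zero_right]; linarith)
    obtain ⟨z, hz, hz'⟩ := hfree z₀ h0 hsub
    have h2 := hg z₀ (mem_closedBall_zero_iff.2 (by linarith)) z (ball_subset_closedBall (hsub hz))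
    rw [mem_ball_iff_norm] at hz hz'
    rw [norm_sub_rev] at hz
    calc ‖g z₀ - z₀‖ ≤ ‖g z₀ - g z‖ + ‖g z - z₀‖ := norm_sub_le_norm_sub_add_norm_sub _ _ _
      _ ≤ K * r + r := add_le_add (h2.trans (by gcongr)) hz'.le
      _ = (K + 1) * r := by ring
  have h2 : ∀ z ∈ Disk, ∃ z₀, r < ‖z₀‖ ∧ ‖z₀‖ ≤ 1 - r ∧ ‖z - z₀‖ ≤ 4 * r := by
    intro z hz
    have hz1 : ‖z‖ ≤ 1 := mem_closedBall_zero_iff.1 hz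
    rcases le_or_gt ‖z‖ (2 * r) with h | h
    · have e : ‖((2 * r : ℝ) : ℂ)‖ = 2 * r := by
        rw [Complex.norm_real, Real.norm_of_nonneg (by positivity)]
      exact ⟨(2 * r : ℝ), by rw [e]; linarith, by rw [e]; linarith,
        (norm_sub_le _ _).trans (by rw [e]; linarith)⟩
    · have e : ‖((1 - r : ℝ) : ℂ) * z‖ = (1 - r) * ‖z‖ := by
        rw [norm_mul, Complex.norm_real, Real.norm_of_nonneg (by linarith)]
      refine ⟨(1 - r : ℝ) * z, by rw [e]; nlinarith, by rw [e]; nlinarith, ?_⟩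
      have e2 : z - ((1 - r : ℝ) : ℂ) * z = (r : ℂ) * z := by
        push_cast
        ring
      rw [e2, norm_mul, Complex.norm_real, Real.norm_of_nonneg hr.le]
      nlinarith
  intro z hz
  obtain ⟨z₀, ha, hb, hc⟩ := h2 z hz
  have h3 := h1 z₀ ha hb
  have h4 := hg z hz z₀ (mem_closedBall_zero_iff.2 (by linarith))
  have h5 : K * ‖z - z₀‖ ≤ K * (4 * r) := by gcongr
  rw [norm_sub_rev] at hc
  calc ‖g z - z‖ ≤ ‖g z - g z₀‖ + ‖g z₀ - z‖ := norm_sub_le_norm_sub_add_norm_sub _ _ _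
    _ ≤ ‖g z - g z₀‖ + (‖g z₀ - z₀‖ + ‖z₀ - z‖) := by
        gcongr
        exact norm_sub_le_norm_sub_add_norm_sub _ _ _
    _ ≤ 10 * K * r := by nlinarith

/-- The Liouville form as a continuous linear form. -/
def lformCLM (z : ℂ) : ℂ →L[ℝ] ℝ :=
  (2 * π)⁻¹ • (z.re • Complex.imCLM - z.im • Complex.reCLM)

theorem lformCLM_apply (z w : ℂ) : lformCLM z w = lform z w := by
  simp [lformCLM, lform]
  ring

theorem abs_lform_le (z w : ℂ) : |lform z w| ≤ ‖z‖ * ‖w‖ / (2 * π) := by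
  have h : z.re * w.im - z.im * w.re = (starRingEnd ℂ z * w).im := by
    simp
    ring
  rw [lform, abs_div, abs_of_pos Real.two_pi_pos, h]
  gcongr
  refine (Complex.abs_im_le_norm _).trans_eq ?_
  rw [norm_mul, Complex.norm_conj]

theorem hasFDerivWithinAt_lform {g : ℂ → ℂ} {D : ℂ →L[ℝ] ℂ} {s : Set ℂ} {z : ℂ}
    (hg : HasFDerivWithinAt g D s z) :
    HasFDerivWithinAt (fun z => lform z (g z)) ((lformCLM z).comp D - lformCLM (g z)) s z := by
  have h1 : HasFDerivWithinAt (fun z : ℂ => z.re) Complex.reCLM s z :=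
    Complex.reCLM.hasFDerivWithinAt
  have h2 : HasFDerivWithinAt (fun z : ℂ => z.im) Complex.imCLM s z :=
    Complex.imCLM.hasFDerivWithinAt
  have h3 := Complex.reCLM.hasFDerivAt.comp_hasFDerivWithinAt z hg
  have h4 := Complex.imCLM.hasFDerivAt.comp_hasFDerivWithinAt z hg
  have h5 := ((h1.mul h4).sub (h2.mul h3)).mul_const (2 * π)⁻¹
  refine h5.congr_fderiv ?_
  ext w
  simp [lformCLM]
  ring

namespace SympDiff

variable (f : SympDiff)

theorem exists_norm_fderivWithin_le :
    ∃ ℓ : ℝ, 1 ≤ ℓ ∧ ∀ z ∈ Disk, ‖fderivWithin ℝ f.toFun Disk z‖ ≤ ℓ := by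
  have hu : UniqueDiffOn ℝ Disk := uniqueDiffOn_convex (convex_closedBall _ _)
    ⟨0, ball_subset_interior_closedBall (mem_ball_self one_pos)⟩
  have h1 := (f.contDiffOn.continuousOn_fderivWithin hu le_rfl).norm
  obtain ⟨C, hC⟩ := (isCompact_closedBall (0 : ℂ) 1).exists_bound_of_continuousOn h1
  refine ⟨max 1 C, le_max_left _ _, fun z hz => ?_⟩
  have := hC z hz
  rw [norm_norm] at this
  exact this.trans (le_max_right _ _)

theorem exists_hasFDerivWithinAt {A : ℂ → ℝ} (hA : IsAction f A) {ℓ : ℝ} (hℓ : 1 ≤ ℓ)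
    (hf : ∀ z ∈ Disk, ‖fderivWithin ℝ f.toFun Disk z‖ ≤ ℓ) (q : ℕ) {z : ℂ} (hz : z ∈ Disk) :
    ∃ D : ℂ →L[ℝ] ℂ, HasFDerivWithinAt f.toFun^[q] D Disk z ∧ ‖D‖ ≤ ℓ ^ q ∧
      HasFDerivWithinAt (birkhoffSum f.toFun A q) ((lformCLM (f.toFun^[q] z)).comp D - lformCLM z)
        Disk z := by
  induction q with
  | zero =>
    refine ⟨ContinuousLinearMap.id ℝ ℂ, hasFDerivWithinAt_id z Disk, by
      simp, ?_⟩
    simp only [Function.iterate_zero, id_eq, ContinuousLinearMap.comp_id, sub_self,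
      birkhoffSum_zero']
    exact hasFDerivWithinAt_const _ _ _
  | succ q ih =>
    obtain ⟨D, h1, h2, h3⟩ := ih
    have hm := f.iterate_mem hz q
    have hmaps : MapsTo f.toFun^[q] Disk Disk := fun w hw => f.iterate_mem hw q
    have h4 := ((f.contDiffOn.differentiableOn one_ne_zero) _ hm).hasFDerivWithinAt.comp z h1 hmaps
    refine ⟨_, by rw [Function.iterate_succ']; exact h4, ?_, ?_⟩
    · rw [pow_succ']
      exact (ContinuousLinearMap.opNorm_comp_le _ _).trans
        (mul_le_mul (hf _ hm) h2 (norm_nonneg _) (by linarith))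
    · have h5 := ((hA.1.differentiableOn one_ne_zero) _ hm).hasFDerivWithinAt.comp z h1 hmaps
      have e : birkhoffSum f.toFun A (q + 1) =
          fun z => birkhoffSum f.toFun A q z + (A ∘ f.toFun^[q]) z := by
        funext z
        exact birkhoffSum_succ _ _ _ _
      rw [e]
      refine (h3.add h5).congr_fderiv ?_
      ext w
      simp only [add_apply, sub_apply,
        ContinuousLinearMap.comp_apply, lformCLM_apply, Function.iterate_succ_apply']
      rw [hA.2 _ hm]
      ring

theorem norm_iterate_sub_le {A : ℂ → ℝ} (hA : IsAction f A) {ℓ : ℝ} (hℓ : 1 ≤ ℓ)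
    (hf : ∀ z ∈ Disk, ‖fderivWithin ℝ f.toFun Disk z‖ ≤ ℓ) (q : ℕ) :
    ∀ z ∈ Disk, ∀ w ∈ Disk, ‖f.toFun^[q] z - f.toFun^[q] w‖ ≤ ℓ ^ q * ‖z - w‖ := by
  intro z hz w hw
  choose! D h1 h2 h3 using fun z hz => f.exists_hasFDerivWithinAt hA hℓ hf q (z := z) hz
  exact (convex_closedBall (0 : ℂ) 1).norm_image_sub_le_of_norm_hasFDerivWithin_le h1 h2 hw hz

/-- The oscillation of the action of an iterate is controlled by its displacement. -/
theorem abs_birkhoffSum_sub_le {A : ℂ → ℝ} (hA : IsAction f A) {ℓ : ℝ} (hℓ : 1 ≤ ℓ)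
    (hf : ∀ z ∈ Disk, ‖fderivWithin ℝ f.toFun Disk z‖ ≤ ℓ) (q : ℕ) {η : ℝ}
    (hη : ∀ z ∈ Disk, ‖f.toFun^[q] z - z‖ ≤ η) :
    ∀ z ∈ Disk, ∀ w ∈ Disk, |birkhoffSum f.toFun A q z - birkhoffSum f.toFun A q w| ≤
      3 * ℓ ^ q * η := by
  choose! D h1 h2 h3 using fun z hz => f.exists_hasFDerivWithinAt hA hℓ hf q (z := z) hz
  have hK : 1 ≤ ℓ ^ q := one_le_pow₀ hℓ
  have hη0 : 0 ≤ η := (norm_nonneg _).trans (hη 0 (mem_closedBall_self zero_le_one))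
  have hpi : (1 : ℝ) ≤ 2 * π := by linarith [Real.pi_gt_three]
  set S : ℂ → ℝ := fun z => birkhoffSum f.toFun A q z - lform z (f.toFun^[q] z) with hS
  have h4 : ∀ z ∈ Disk, ∀ w ∈ Disk, ‖S z - S w‖ ≤ η * (ℓ ^ q + 1) / (2 * π) * ‖z - w‖ := by
    intro z hz w hw
    refine (convex_closedBall (0 : ℂ) 1).norm_image_sub_le_of_norm_hasFDerivWithin_le
      (fun x hx => (h3 x hx).sub (hasFDerivWithinAt_lform (h1 x hx))) (fun x hx => ?_) hw hz
    refine ContinuousLinearMap.opNorm_le_bound _ (by positivity) fun v => ?_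
    have e : ((lformCLM (f.toFun^[q] x)).comp (D x) - lformCLM x -
        ((lformCLM x).comp (D x) - lformCLM (f.toFun^[q] x))) v =
        lform (f.toFun^[q] x - x) (D x v + v) := by
      simp only [sub_apply, ContinuousLinearMap.comp_apply, lformCLM_apply]
      simp only [lform, Complex.sub_re, Complex.sub_im, Complex.add_re, Complex.add_im]
      ring
    rw [e]
    refine (abs_lform_le _ _).trans ?_
    rw [div_mul_eq_mul_div, mul_assoc η]
    gcongr
    · exact hη x hx
    · refine (norm_add_le _ _).trans ?_
      have := (D x).le_of_opNorm_le (h2 x hx) v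
      linarith
  have h5 : ∀ z ∈ Disk, |lform z (f.toFun^[q] z)| ≤ η / (2 * π) := by
    intro z hz
    have e : lform z (f.toFun^[q] z) = lform z (f.toFun^[q] z - z) := by
      simp only [lform, Complex.sub_re, Complex.sub_im]
      ring
    rw [e]
    refine (abs_lform_le _ _).trans ?_
    gcongr
    calc ‖z‖ * ‖f.toFun^[q] z - z‖ ≤ 1 * η :=
          mul_le_mul (mem_closedBall_zero_iff.1 hz) (hη z hz) (norm_nonneg _) zero_le_one
      _ = η := one_mul _
  intro z hz w hw
  have h6 := h4 z hz w hw
  have h7 : ‖z - w‖ ≤ 2 := by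
    have := norm_sub_le z w
    have := mem_closedBall_zero_iff.1 hz
    have := mem_closedBall_zero_iff.1 hw
    linarith
  have h8 : ‖S z - S w‖ ≤ η * (ℓ ^ q + 1) / (2 * π) * 2 := h6.trans (by gcongr)
  have h9 := h5 z hz
  have h10 := h5 w hw
  rw [Real.norm_eq_abs] at h8
  have e : birkhoffSum f.toFun A q z - birkhoffSum f.toFun A q w =
      (S z - S w) + (lform z (f.toFun^[q] z) - lform w (f.toFun^[q] w)) := by
    simp only [hS]
    ring
  rw [e]
  have h11 : η * (ℓ ^ q + 1) / (2 * π) * 2 + (η / (2 * π) + η / (2 * π)) ≤ 3 * ℓ ^ q * η := by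
    have : η * (ℓ ^ q + 1) / (2 * π) * 2 + (η / (2 * π) + η / (2 * π)) =
        η * (ℓ ^ q + 2) / π := by
      field_simp
      ring
    rw [this, div_le_iff₀ Real.pi_pos]
    have h12 : η * (ℓ ^ q + 2) ≤ 3 * ℓ ^ q * η := by nlinarith
    have h13 : 0 ≤ 3 * ℓ ^ q * η := by positivity
    nlinarith [Real.pi_gt_three]
  calc _ ≤ |S z - S w| + |lform z (f.toFun^[q] z) - lform w (f.toFun^[q] w)| := abs_add_le _ _
    _ ≤ |S z - S w| + (|lform z (f.toFun^[q] z)| + |lform w (f.toFun^[q] w)|) := by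
        gcongr
        exact abs_sub _ _
    _ ≤ _ := by linarith

theorem integral_birkhoffSum {ν : Measure ℂ} [IsFiniteMeasure ν] (hν : ν Diskᶜ = 0)
    (hT : MeasurePreserving f.ext ν ν) {A : ℂ → ℝ} (hA : ContinuousOn A Disk) (q : ℕ) :
    Integrable (birkhoffSum f.toFun A q) ν ∧
      ∫ z, birkhoffSum f.toFun A q z ∂ν = q * ∫ z, A z ∂ν := by
  have hDm : MeasurableSet Disk := isClosed_closedBall.measurableSet
  have hae : ∀ᵐ z ∂ν, z ∈ Disk := hν
  have hr : ν.restrict Disk = ν := Measure.restrict_eq_self_of_ae_mem hae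
  have hAi : Integrable A ν := by
    rw [← hr]
    exact hA.integrableOn_compact (isCompact_closedBall _ _)
  have h1 : ∀ i, Integrable (fun z => A (f.toFun^[i] z)) ν ∧
      ∫ z, A (f.toFun^[i] z) ∂ν = ∫ z, A z ∂ν := by
    intro i
    have hTi := hT.iterate i
    have e : (fun z => A (f.toFun^[i] z)) =ᵐ[ν] fun z => A (f.ext^[i] z) := by
      filter_upwards [hae] with z hz
      rw [f.ext_iterate hz]
    refine ⟨(hTi.integrable_comp_of_integrable hAi).congr e.symm, ?_⟩
    rw [integral_congr_ae e, ← integral_map hTi.measurable.aemeasurable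
      (by rw [hTi.map_eq]; exact hAi.aestronglyMeasurable), hTi.map_eq]
  simp only [birkhoffSum]
  refine ⟨integrable_finsetSum _ fun i _ => (h1 i).1, ?_⟩
  rw [integral_finsetSum _ fun i _ => (h1 i).1]
  simp [(h1 _).2]

theorem measurePreserving_ext_of_map_eq {μ : Measure ℂ} [IsProbabilityMeasure μ]
    (hμ : μ Diskᶜ = 0) (hmap : Measure.map f.toFun μ = μ) : MeasurePreserving f.ext μ μ := by
  refine ⟨f.measurable_ext, ?_⟩
  have hae : ∀ᵐ z ∂μ, z ∈ Disk := hμ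
  have e : f.ext =ᵐ[μ] f.toFun := by
    filter_upwards [hae] with z hz using f.ext_of_mem hz
  rw [Measure.map_congr e, hmap]

/-- The integral of the action is controlled by the displacement of the iterates. -/
theorem abs_integral_le {A : ℂ → ℝ} (hA : IsNormalizedAction f A) {ℓ : ℝ} (hℓ : 1 ≤ ℓ)
    (hf : ∀ z ∈ Disk, ‖fderivWithin ℝ f.toFun Disk z‖ ≤ ℓ) {q : ℕ} (hq : 1 ≤ q) {η : ℝ}
    (hη : ∀ z ∈ Disk, ‖f.toFun^[q] z - z‖ ≤ η) :
    |∫ z in Disk, A z| ≤ 3 * ℓ ^ q * η * π := by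
  obtain ⟨hA, μ, ⟨hμp, hμc, hmap⟩, hμ0⟩ := hA
  have hμD : μ Diskᶜ = 0 :=
    measure_mono_null (compl_subset_compl.2 sphere_subset_closedBall) hμc
  have hac := hA.1.continuousOn
  obtain ⟨hi, he⟩ := f.integral_birkhoffSum hμD (f.measurePreserving_ext_of_map_eq hμD hmap) hac q
  rw [hμ0, mul_zero] at he
  have hosc := f.abs_birkhoffSum_sub_le hA hℓ hf q hη
  have hbd : ∀ z ∈ Disk, ‖birkhoffSum f.toFun A q z‖ ≤ 3 * ℓ ^ q * η := by
    intro z hz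
    have h1 : ∫ w, (birkhoffSum f.toFun A q z - birkhoffSum f.toFun A q w) ∂μ =
        birkhoffSum f.toFun A q z := by
      rw [integral_sub (integrable_const _) hi, he, integral_const]
      simp
    have hae : ∀ᵐ w ∂μ, w ∈ Disk := hμD
    have h2 := norm_integral_le_of_norm_le_const (μ := μ) (C := 3 * ℓ ^ q * η)
      (f := fun w => birkhoffSum f.toFun A q z - birkhoffSum f.toFun A q w)
      (by filter_upwards [hae] with w hw using hosc z hz w hw)
    rw [h1] at h2
    simpa using h2
  have hDm : MeasurableSet Disk := isClosed_closedBall.measurableSet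
  have hvol : (volume Disk) = ENNReal.ofReal π := by
    rw [Disk, Complex.volume_closedBall]
    simp [← NNReal.coe_real_pi, ENNReal.ofReal_coe_nnreal]
  have h3 := (f.integral_birkhoffSum (ν := volume.restrict Disk)
    (by rw [Measure.restrict_apply hDm.compl]; simp) f.measurePreserving_ext hac q).2
  have h4 := norm_setIntegral_le_of_norm_le_const (μ := volume) (s := Disk)
    (by rw [hvol]; exact ENNReal.ofReal_lt_top) hbd
  rw [h3, Measure.real, hvol, ENNReal.toReal_ofReal Real.pi_pos.le, norm_mul, Real.norm_natCast,
    Real.norm_eq_abs] at h4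
  refine le_trans ?_ h4
  have : (1 : ℝ) ≤ q := by exact_mod_cast hq
  nlinarith [abs_nonneg (∫ z in Disk, A z)]

end SympDiff

namespace GenContFract

theorem not_terminatedAt_of_irrational {α : ℝ} (h : Irrational α) (n : ℕ) :
    ¬(GenContFract.of α).TerminatedAt n := by
  intro hn
  obtain ⟨q, hq⟩ := (GenContFract.terminates_iff_rat α).1 ⟨n, hn⟩
  exact h ⟨q, hq.symm⟩

theorem exists_int_contsAux_of_irrational {α : ℝ} (h : Irrational α) (n : ℕ) :
    ∃ a b : ℤ, (GenContFract.of α).contsAux n = ⟨(a : ℝ), (b : ℝ)⟩ := by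
  have key : (∃ a b : ℤ, (GenContFract.of α).contsAux n = ⟨(a : ℝ), (b : ℝ)⟩) ∧
      ∃ a b : ℤ, (GenContFract.of α).contsAux (n + 1) = ⟨(a : ℝ), (b : ℝ)⟩ := by
    induction n with
    | zero =>
      refine ⟨⟨1, 0, by simp [contsAux]⟩, ⟨⌊α⌋, 1, ?_⟩⟩
      simp [contsAux, GenContFract.of_h_eq_floor]
    | succ n ih =>
      obtain ⟨⟨a, b, hab⟩, ⟨c, d, hcd⟩⟩ := ih
      refine ⟨⟨c, d, hcd⟩, ?_⟩
      obtain ⟨gp, hgp⟩ := Option.ne_none_iff_exists'.1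
        (not_terminatedAt_of_irrational h n)
      obtain ⟨h1, z, hz⟩ := of_partNum_eq_one_and_exists_int_partDen_eq hgp
      refine ⟨z * c + a, z * d + b, ?_⟩
      rw [contsAux_recurrence hgp hab hcd, h1, hz]
      simp
  exact key.1

end GenContFract

/-- Super Liouville numbers are approximated by rationals with an error smaller than any
exponential of the denominator. -/
theorem exists_abs_mul_sub_lt_exp {α : ℝ} (hirr : Irrational α)
    (hsL : ∀ C : ℝ, ∃ᶠ n in Filter.atTop,
      C < Real.log ((GenContFract.of α).dens (n + 1)) / (GenContFract.of α).dens n) (C : ℝ) :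
    ∃ q : ℕ, 1 ≤ q ∧ ∃ p : ℤ, (q : ℝ) * α - p ≠ 0 ∧ |(q : ℝ) * α - p| < Real.exp (-(C * q)) := by
  obtain ⟨n, hn⟩ := (hsL C).exists
  have hone : ∀ k, 1 ≤ (GenContFract.of α).dens k := fun k => by
    have := GenContFract.succ_nth_fib_le_of_nth_den (v := α) (n := k)
      (Or.inr (GenContFract.not_terminatedAt_of_irrational hirr _))
    refine le_trans ?_ this
    exact_mod_cast Nat.fib_pos.2 (Nat.succ_pos k)
  obtain ⟨a, b, hab⟩ := GenContFract.exists_int_contsAux_of_irrational hirr (n + 1)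
  have ha : (GenContFract.of α).nums n = a := by
    rw [GenContFract.num_eq_conts_a, GenContFract.nth_cont_eq_succ_nth_contAux, hab]
  have hb : (GenContFract.of α).dens n = b := by
    rw [GenContFract.den_eq_conts_b, GenContFract.nth_cont_eq_succ_nth_contAux, hab]
  have h1 := hone n
  have h2 := hone (n + 1)
  have happ := GenContFract.abs_sub_convs_le
    (GenContFract.not_terminatedAt_of_irrational hirr n)
  rw [GenContFract.conv_eq_num_div_den, ha, hb] at happ
  rw [hb] at hn h1
  set D := (GenContFract.of α).dens (n + 1)
  have hb0 : 1 ≤ b := by exact_mod_cast h1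
  obtain ⟨q, rfl⟩ := Int.eq_ofNat_of_zero_le (by linarith : 0 ≤ b)
  simp only [Int.cast_natCast] at *
  have hq0 : (0 : ℝ) < q := by linarith
  refine ⟨q, by exact_mod_cast h1, a, ?_, ?_⟩
  · intro h0
    refine hirr ⟨(a : ℚ) / q, ?_⟩
    push_cast
    field_simp
    linarith
  · have e : (q : ℝ) * α - a = q * (α - a / q) := by field_simp
    rw [e, abs_mul, abs_of_pos hq0]
    have hD : C * q < Real.log D := by rwa [lt_div_iff₀ hq0] at hn
    calc (q : ℝ) * |α - a / q| ≤ q * (1 / (q * D)) := by gcongr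
      _ = D⁻¹ := by field_simp
      _ = Real.exp (-Real.log D) := by rw [Real.exp_neg, Real.exp_log (by linarith)]
      _ < _ := Real.exp_lt_exp.2 (by linarith)

/-- A `C^∞` irrational pseudo-rotation of the disk whose rotation
number is super Liouville has vanishing Calabi invariant. -/
theorem cal_pseudo_rotation_superLiouville (f : SympDiff)
    (hsmooth : ContDiffOn ℝ (⊤ : ℕ∞) f.toFun Disk) (hsmooth' : ContDiffOn ℝ (⊤ : ℕ∞) f.invFun Disk)
    (hfix : f.toFun 0 = 0)
    (hpseudo : ∀ z ∈ Disk, z ≠ 0 → ∀ n : ℕ, 1 ≤ n → f.toFun^[n] z ≠ z)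
    (lift : ℝ → ℝ) (hlift_cont : Continuous lift) (hlift_mono : StrictMono lift)
    (hlift_per : ∀ θ : ℝ, lift (θ + 1) = lift θ + 1)
    (hlift_proj : ∀ θ : ℝ,
      f.toFun (Complex.exp (2 * Real.pi * Complex.I * θ)) =
        Complex.exp (2 * Real.pi * Complex.I * lift θ))
    (α : ℝ)
    (hα : ∀ θ : ℝ, Filter.Tendsto (fun n : ℕ => (lift^[n] θ - θ) / n)
      Filter.atTop (nhds α))
    (hirr : Irrational α)
    (hsL : ∀ C : ℝ, ∃ᶠ n in Filter.atTop,
      C < Real.log ((GenContFract.of α).dens (n + 1)) / (GenContFract.of α).dens n)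
    (A : ℂ → ℝ) (hA : IsNormalizedAction f A) :
    (1 / Real.pi) * ∫ z in Disk, A z = 0 := by
  obtain ⟨F, L, hF⟩ := f.exists_plane_lift hfix hlift_cont hlift_mono hlift_per hlift_proj
  have hrot : RotatesBy F α := fun m hm U hU y n k hn hy hk p =>
    hF.winding hpseudo hlift_mono hlift_per hlift_proj hα hm hU hn hy hk p
  obtain ⟨ℓ, hℓ, hfℓ⟩ := f.exists_norm_fderivWithin_le
  have hℓ0 : 0 < ℓ := by linarith
  have hlog : 0 ≤ Real.log ℓ := Real.log_nonneg hℓ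
  have bound : ∀ t : ℝ, 7 ≤ t → |∫ z in Disk, A z| ≤ 60 * Real.pi * Real.exp (-t) := by
    intro t ht
    obtain ⟨q, hq, p, hp0, hp⟩ := exists_abs_mul_sub_lt_exp hirr hsL (4 * Real.log ℓ + 2 * t)
    have hq1 : (1 : ℝ) ≤ q := by exact_mod_cast hq
    set s : ℝ := (2 * Real.log ℓ + t) * q with hs
    have hts : t ≤ s := by rw [hs]; nlinarith
    have hCs : (4 * Real.log ℓ + 2 * t) * q = 2 * s := by rw [hs]; ring
    rw [hCs] at hp
    set N : ℕ := ⌊Real.exp (2 * s)⌋₊ with hN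
    have hE : 8 ≤ Real.exp s := by linarith [Real.add_one_le_exp s]
    have hEE : Real.exp (2 * s) = Real.exp s ^ 2 := by rw [two_mul, Real.exp_add, sq]
    have hNle : (N : ℝ) ≤ Real.exp (2 * s) := Nat.floor_le (Real.exp_pos _).le
    have hNgt : Real.exp (2 * s) < N + 1 := Nat.lt_floor_add_one _
    have hN2 : (2 : ℝ) ≤ N := by nlinarith
    have hN1 : 1 ≤ N := by
      have : (1 : ℝ) ≤ N := by linarith
      exact_mod_cast this
    have hpN : (N : ℝ) * |(q : ℝ) * α - p| < 1 := by
      calc (N : ℝ) * |(q : ℝ) * α - p| < N * Real.exp (-(2 * s)) := by gcongr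
        _ ≤ Real.exp (2 * s) * Real.exp (-(2 * s)) := by gcongr
        _ = 1 := by rw [← Real.exp_add]; simp
    set r : ℝ := 2 * Real.exp (-s) with hr
    have hr0 : 0 < r := by positivity
    have hrE : r * Real.exp s = 2 := by
      rw [hr, mul_assoc, ← Real.exp_add]; simp
    have hr4 : r ≤ 1 / 4 := by nlinarith
    have hNr : 1 < N * r ^ 2 := by
      have h4 : Real.exp (2 * s) * r ^ 2 = 4 := by
        rw [hEE, ← mul_pow, mul_comm, hrE]; norm_num
      nlinarith [sq_nonneg r]
    have hdisp : ∀ z ∈ Disk, ‖f.toFun^[q] z - z‖ ≤ 10 * ℓ ^ q * r := by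
      refine displacement_le (one_le_pow₀ hℓ) hr0 hr4
        (f.norm_iterate_sub_le hA.1 hℓ hfℓ q) fun z₀ hz₀ hB => ?_
      by_contra! hfree
      exact absurd (hF.mul_sq_le_one_of_free hpseudo hrot hq hN1 hp0 hpN hr0.le hz₀ hB hfree)
        (not_le.2 hNr)
    have hpow : ℓ ^ q = Real.exp (q * Real.log ℓ) := by
      rw [Real.exp_nat_mul, Real.exp_log hℓ0]
    calc |∫ z in Disk, A z| ≤ 3 * ℓ ^ q * (10 * ℓ ^ q * r) * Real.pi :=
          f.abs_integral_le hA hℓ hfℓ hq hdisp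
      _ = 60 * Real.pi * (Real.exp (q * Real.log ℓ) * Real.exp (q * Real.log ℓ) *
            Real.exp (-s)) := by rw [hpow, hr]; ring
      _ = 60 * Real.pi * Real.exp (-(t * q)) := by
          rw [← Real.exp_add, ← Real.exp_add, hs]; ring_nf
      _ ≤ 60 * Real.pi * Real.exp (-t) := by
          gcongr
          nlinarith
  have hlim : Tendsto (fun t : ℝ => 60 * Real.pi * Real.exp (-t)) atTop (𝓝 0) := by
    simpa using Real.tendsto_exp_neg_atTop_nhds_zero.const_mul (60 * Real.pi)
  have hzero : ∫ z in Disk, A z = 0 := abs_nonpos_iff.1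
    (ge_of_tendsto hlim ((eventually_ge_atTop 7).mono bound))
  rw [hzero, mul_zero]
end
end

section
/- Let 0 < ε < 1/4 and let f : D → ℝ² be a map with ‖f(z) − z‖ ≤ ε for all z ∈ D. Then for all x, y ∈ D with ‖x − y‖ ≥ √ε one has f(x) ≠ f(y) and |⟨(f(y) − f(x))/‖f(y) − f(x)‖, (y − x)/‖y − x‖⟩ − 1| ≤ 4√ε. -/
open MeasureTheory Metric Set Filter Topology
open scoped Real

noncomputable section

/-- Normalizing two nonzero vectors distorts their distance, measured relative to the length of
the second one, by a factor of at most `2`. -/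
theorem norm_mul_norm_div_norm_sub_div_norm_le {w d : ℂ} (hw : w ≠ 0) (hd : d ≠ 0) :
    ‖d‖ * ‖w / (‖w‖ : ℂ) - d / (‖d‖ : ℂ)‖ ≤ 2 * ‖w - d‖ := by
  have hw' : (‖w‖ : ℂ) ≠ 0 := by simpa using hw
  have hd' : (‖d‖ : ℂ) ≠ 0 := by simpa using hd
  have hunit : ‖w / (‖w‖ : ℂ)‖ = 1 := by simp [hw]
  have key : (‖d‖ : ℂ) * (w / (‖w‖ : ℂ) - d / (‖d‖ : ℂ)) =
      ((‖d‖ - ‖w‖ : ℝ) : ℂ) * (w / (‖w‖ : ℂ)) + (w - d) := by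
    push_cast
    field_simp
    ring
  calc ‖d‖ * ‖w / (‖w‖ : ℂ) - d / (‖d‖ : ℂ)‖
      = ‖(‖d‖ : ℂ) * (w / (‖w‖ : ℂ) - d / (‖d‖ : ℂ))‖ := by simp
    _ ≤ |‖d‖ - ‖w‖| + ‖w - d‖ := by
        rw [key]
        refine (norm_add_le _ _).trans ?_
        rw [norm_mul, hunit, mul_one, Complex.norm_real, Real.norm_eq_abs]
    _ ≤ 2 * ‖w - d‖ := by
        have := abs_norm_sub_norm_le d w
        rw [norm_sub_rev] at this
        linarith

/-- The real part of `u * conj v` differs from `1` by at most `‖u - v‖` when `v` is a unit. -/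
theorem abs_re_mul_conj_sub_one_le {u v : ℂ} (hv : ‖v‖ = 1) :
    |(u * (starRingEnd ℂ) v).re - 1| ≤ ‖u - v‖ := by
  have h : (u * (starRingEnd ℂ) v).re - 1 = ((u - v) * (starRingEnd ℂ) v).re := by
    rw [sub_mul, Complex.sub_re, Complex.mul_conj, Complex.normSq_eq_norm_sq, hv]
    simp
  calc |(u * (starRingEnd ℂ) v).re - 1| ≤ ‖(u - v) * (starRingEnd ℂ) v‖ := by
        rw [h]
        exact Complex.abs_re_le_norm _
    _ = ‖u - v‖ := by rw [norm_mul, RCLike.norm_conj, hv, mul_one]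

/-- If `f` is `ε`-close to the identity (`ε < 1/4`), then for points at
distance at least `√ε` the cosine of the angle between `f(y) - f(x)` and `y - x` is
`4√ε`-close to `1`. -/
theorem cos_angle_close_C0 (ε : ℝ) (hε0 : 0 < ε) (hε : ε < 1 / 4) (f : ℂ → ℂ)
    (hf : ∀ z ∈ Disk, ‖f z - z‖ ≤ ε) :
    ∀ x ∈ Disk, ∀ y ∈ Disk, Real.sqrt ε ≤ ‖x - y‖ →
      f x ≠ f y ∧
      |(((f y - f x) / (‖f y - f x‖ : ℂ)) *
          (starRingEnd ℂ) ((y - x) / (‖y - x‖ : ℂ))).re - 1| ≤ 4 * Real.sqrt ε := by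
  intro x hx y hy hxy
  have hsq : √ε * √ε = ε := Real.mul_self_sqrt hε0.le
  have hs0 : 0 < √ε := Real.sqrt_pos.mpr hε0
  have hs1 : √ε < 1 / 2 := by nlinarith
  rw [norm_sub_rev] at hxy
  have hdist : ‖(f y - f x) - (y - x)‖ ≤ 2 * ε := by
    have h : (f y - f x) - (y - x) = (f y - y) - (f x - x) := by ring
    rw [h]
    linarith [norm_sub_le (f y - y) (f x - x), hf x hx, hf y hy]
  have hd : y - x ≠ 0 := norm_pos_iff.mp (hs0.trans_le hxy)
  have hw : f y - f x ≠ 0 := by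
    intro h
    rw [h, zero_sub, norm_neg] at hdist
    nlinarith
  refine ⟨fun h => hw (by rw [h, sub_self]), ?_⟩
  refine (abs_re_mul_conj_sub_one_le (by simp [hd])).trans ?_
  have hnorm := norm_mul_norm_div_norm_sub_div_norm_le hw hd
  refine le_of_mul_le_mul_left ?_ hs0
  calc √ε * _ ≤ ‖y - x‖ * _ := mul_le_mul_of_nonneg_right hxy (norm_nonneg _)
    _ ≤ 2 * ‖(f y - f x) - (y - x)‖ := hnorm
    _ ≤ √ε * (4 * √ε) := by linarith
end
end
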